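/- Assume the commutation hypothesis: 𝓕^{τ'}_{u,v} ∘ 𝓖^{τ''}_ω = 𝓖^{τ''}_ω ∘ 𝓕^{τ'}_{u,v} for all u ∈ P, v ∈ Q, ω ∈ Ω and all τ', τ'' ≥ 0. Let E ⊆ [0,ϑ] × ℝⁿ be closed with M ⊆ E, and suppose E decreases by sections relative to ẋ = g(x,ω), ω ∈ Ω. Then A(E) = A*(E). -/

import Mathlib

open MeasureTheory

noncomputable section

/-- A slide control on `[0,ϑ] × Λ`: a Borel measure on `ℝ × C` carried by `[0,ϑ] × Λ`
whose marginal on the time axis is Lebesgue measure on `[0,ϑ]`. -/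
def IsSlideControl {C : Type*} [MeasurableSpace C] (ϑ : ℝ) (Λ : Set C)
    (μ : Measure (ℝ × C)) : Prop :=
  μ.map Prod.fst = volume.restrict (Set.Icc 0 ϑ) ∧ μ ((Set.Icc 0 ϑ ×ˢ Λ)ᶜ) = 0

/-- A motion of `ẋ = h(x,b)` generated by the slide control `μ` from the position
`(t₀, x₀)`. -/
def IsMotion {C : Type*} {n : ℕ} [MeasurableSpace C] (ϑ : ℝ) (Λ : Set C)
    (h : EuclideanSpace ℝ (Fin n) → C → EuclideanSpace ℝ (Fin n))
    (μ : Measure (ℝ × C)) (t₀ : ℝ) (x₀ : EuclideanSpace ℝ (Fin n))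
    (x : ℝ → EuclideanSpace ℝ (Fin n)) : Prop :=
  ContinuousOn x (Set.Icc 0 ϑ) ∧ x t₀ = x₀ ∧
  (∀ t ∈ Set.Icc 0 ϑ, t₀ ≤ t →
    x t = x₀ + ∫ z in Set.Icc t₀ t ×ˢ Λ, h (x z.1) z.2 ∂μ) ∧
  (∀ t ∈ Set.Icc 0 ϑ, t ≤ t₀ →
    x t = x₀ - ∫ z in Set.Icc t t₀ ×ˢ Λ, h (x z.1) z.2 ∂μ)

/-- `E` decreases by sections relative to the control system `ẋ = g(x,ω)`, `ω ∈ Ω`. -/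
def DecreasesBySections {n m : ℕ} (ϑ : ℝ) (Ω : Set (EuclideanSpace ℝ (Fin m)))
    (g : EuclideanSpace ℝ (Fin n) → EuclideanSpace ℝ (Fin m) → EuclideanSpace ℝ (Fin n))
    (E : Set (ℝ × EuclideanSpace ℝ (Fin n))) : Prop :=
  ∀ tstar xstar, (tstar, xstar) ∈ E → ∀ t ∈ Set.Icc 0 tstar,
    ∀ σ : Measure (ℝ × EuclideanSpace ℝ (Fin m)), IsSlideControl ϑ Ω σ →
      ∀ y : ℝ → EuclideanSpace ℝ (Fin n), IsMotion ϑ Ω g σ tstar xstar y → (t, y t) ∈ E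

/-- The program absorption operator `A*` of the transformed game `ẋ = f*(x,(ν,u,ω),v)`,
`(ν,u,ω) ∈ P* = {0,1} × P × Ω`, with target set `{ϑ} × F`. -/
def progAbsorbStar {n p q m : ℕ} (ϑ : ℝ)
    (P : Set (EuclideanSpace ℝ (Fin p))) (Q : Set (EuclideanSpace ℝ (Fin q)))
    (Ω : Set (EuclideanSpace ℝ (Fin m)))
    (f : EuclideanSpace ℝ (Fin n) → EuclideanSpace ℝ (Fin p) → EuclideanSpace ℝ (Fin q) →
      EuclideanSpace ℝ (Fin n))
    (g : EuclideanSpace ℝ (Fin n) → EuclideanSpace ℝ (Fin m) → EuclideanSpace ℝ (Fin n))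
    (F : Set (EuclideanSpace ℝ (Fin n))) (E : Set (ℝ × EuclideanSpace ℝ (Fin n))) :
    Set (ℝ × EuclideanSpace ℝ (Fin n)) :=
  {pt ∈ E | ∀ v ∈ Q,
    ∃ μ : Measure (ℝ × (ℝ × EuclideanSpace ℝ (Fin p) × EuclideanSpace ℝ (Fin m))),
      IsSlideControl ϑ (({0, 1} : Set ℝ) ×ˢ P ×ˢ Ω) μ ∧
      ∃ y : ℝ → EuclideanSpace ℝ (Fin n),
        IsMotion ϑ (({0, 1} : Set ℝ) ×ˢ P ×ˢ Ω)
          (fun x ustar => ustar.1 • f x ustar.2.1 v + (1 - ustar.1) • g x ustar.2.2)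
          μ pt.1 pt.2 y ∧
        y ϑ ∈ F ∧ ∀ t ∈ Set.Icc pt.1 ϑ, (t, y t) ∈ E}

/-- The program absorption operator `A` of the original game `ẋ = f(x,u,v)` with target
set `M`. -/
def progAbsorb {n p q : ℕ} (ϑ : ℝ)
    (P : Set (EuclideanSpace ℝ (Fin p))) (Q : Set (EuclideanSpace ℝ (Fin q)))
    (f : EuclideanSpace ℝ (Fin n) → EuclideanSpace ℝ (Fin p) → EuclideanSpace ℝ (Fin q) →
      EuclideanSpace ℝ (Fin n))
    (M E : Set (ℝ × EuclideanSpace ℝ (Fin n))) : Set (ℝ × EuclideanSpace ℝ (Fin n)) :=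
  {pt ∈ E | ∀ v ∈ Q, ∃ μ : Measure (ℝ × EuclideanSpace ℝ (Fin p)),
    IsSlideControl ϑ P μ ∧ ∃ ξ ∈ Set.Icc pt.1 ϑ, ∃ y : ℝ → EuclideanSpace ℝ (Fin n),
      IsMotion ϑ P (fun x u => f x u v) μ pt.1 pt.2 y ∧ (ξ, y ξ) ∈ M ∧
      ∀ t ∈ Set.Icc pt.1 ξ, (t, y t) ∈ E}

namespace SlideAux

set_option linter.unusedSectionVars false

open Set Metric

section Basic

variable {C : Type*} [MetricSpace C] [SecondCountableTopology C] [MeasurableSpace C] [BorelSpace C]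
variable {V : Type*} [NormedAddCommGroup V] [NormedSpace ℝ V] [FiniteDimensional ℝ V]

/-- Cumulative integral. -/
def Fint (μ : Measure (ℝ × C)) (φ : ℝ × C → V) (t : ℝ) : V :=
  ∫ z in {z : ℝ × C | z.1 ≤ t}, φ z ∂μ

structure Adm (ϑ : ℝ) (Λ : Set C) (μ : Measure (ℝ × C)) : Prop where
  marg : μ.map Prod.fst ≤ volume.restrict (Icc 0 ϑ)
  supp : ∀ᵐ z ∂μ, z.2 ∈ Λ

structure Sys (Λ : Set C) (h : V → C → V) : Prop where
  cpt : IsCompact Λ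
  cont : Continuous fun z : V × C => h z.1 z.2
  lip : ∀ R : ℝ, ∃ L : NNReal, ∀ b ∈ Λ, LipschitzOnWith L (fun x => h x b) (closedBall 0 R)
  grow : ∃ c > (0 : ℝ), ∀ x, ∀ b ∈ Λ, ‖h x b‖ ≤ c * (1 + ‖x‖)

structure IsSol (h : V → C → V) (μ : Measure (ℝ × C)) (x : ℝ → V) : Prop where
  cont : Continuous x
  eq : ∀ s t, x t - x s = Fint μ (fun z => h (x z.1) z.2) t - Fint μ (fun z => h (x z.1) z.2) s

theorem Adm.finite {ϑ : ℝ} {Λ : Set C} {μ : Measure (ℝ × C)} (hμ : Adm ϑ Λ μ) :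
    IsFiniteMeasure μ := by
  constructor
  have h1 := hμ.marg univ
  rw [Measure.map_apply measurable_fst MeasurableSet.univ] at h1
  refine lt_of_le_of_lt h1 ?_
  simp

theorem Adm.time {ϑ : ℝ} {Λ : Set C} {μ : Measure (ℝ × C)} (hμ : Adm ϑ Λ μ) :
    ∀ᵐ z ∂μ, z.1 ∈ Icc 0 ϑ := by
  have h1 : ∀ᵐ t ∂(μ.map Prod.fst), t ∈ Icc 0 ϑ :=
    (Measure.absolutelyContinuous_of_le hμ.marg).ae_le (ae_restrict_mem measurableSet_Icc)
  exact ae_of_ae_map measurable_fst.aemeasurable h1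

theorem Adm.mono {ϑ : ℝ} {Λ : Set C} {μ μ' : Measure (ℝ × C)} (hμ : Adm ϑ Λ μ) (h : μ' ≤ μ) :
    Adm ϑ Λ μ' :=
  ⟨(Measure.map_mono h measurable_fst).trans hμ.marg,
    (Measure.absolutelyContinuous_of_le h).ae_le hμ.supp⟩

theorem Adm.integrable {ϑ : ℝ} {Λ : Set C} {μ : Measure (ℝ × C)} (hμ : Adm ϑ Λ μ)
    (hΛ : IsCompact Λ) {φ : ℝ × C → V} (hφ : Continuous φ) : Integrable φ μ := by
  have := hμ.finite
  obtain ⟨B, hB⟩ := (isCompact_Icc.prod hΛ).exists_bound_of_continuousOn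
    (s := Icc 0 ϑ ×ˢ Λ) hφ.continuousOn
  refine Integrable.of_bound hφ.aestronglyMeasurable B ?_
  filter_upwards [hμ.time, hμ.supp] with z h1 h2
  exact hB z ⟨h1, h2⟩

theorem measSet_le (t : ℝ) : MeasurableSet {z : ℝ × C | z.1 ≤ t} :=
  measurableSet_le measurable_fst measurable_const

theorem measSet_Ioc (s t : ℝ) : MeasurableSet {z : ℝ × C | z.1 ∈ Ioc s t} :=
  measurable_fst measurableSet_Ioc

theorem Fint_sub {μ : Measure (ℝ × C)} {φ : ℝ × C → V} (hφ : Integrable φ μ) {s t : ℝ}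
    (hst : s ≤ t) :
    Fint μ φ t - Fint μ φ s = ∫ z in {z : ℝ × C | z.1 ∈ Ioc s t}, φ z ∂μ := by
  have : {z : ℝ × C | z.1 ≤ t} = {z : ℝ × C | z.1 ≤ s} ∪ {z : ℝ × C | z.1 ∈ Ioc s t} := by
    ext z; simp only [mem_ofPred_eq, mem_union, mem_Ioc]
    constructor
    · intro h; by_cases h' : z.1 ≤ s
      · exact Or.inl h'
      · exact Or.inr ⟨not_le.1 h', h⟩
    · rintro (h | h)
      · exact h.trans hst
      · exact h.2
  unfold Fint
  rw [this, setIntegral_union _ (measSet_Ioc s t) hφ.integrableOn hφ.integrableOn]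
  · abel
  · rw [Set.disjoint_left]; intro z h1 h2; exact absurd h1 (not_le.2 h2.1)

theorem incr {ϑ : ℝ} {Λ : Set C} {μ : Measure (ℝ × C)} (hμ : Adm ϑ Λ μ) {φ : ℝ × C → V}
    (hφ : Integrable φ μ) {a : ℝ → ℝ} (ha : Continuous a) (ha0 : ∀ t, 0 ≤ a t)
    {s t : ℝ} (hst : s ≤ t) (hb : ∀ᵐ z ∂μ, z.1 ∈ Ioc s t → ‖φ z‖ ≤ a z.1) :
    ‖Fint μ φ t - Fint μ φ s‖ ≤ ∫ r in s..t, a r := by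
  have := hμ.finite
  rw [Fint_sub hφ hst]
  have hai : IntegrableOn a (Ioc s t) volume :=
    (ha.integrableOn_Icc).mono_set Ioc_subset_Icc_self
  have hmarg : (μ.map Prod.fst).restrict (Ioc s t) ≤ volume.restrict (Ioc s t) :=
    Measure.restrict_mono le_rfl (hμ.marg.trans Measure.restrict_le_self)
  have hai' : IntegrableOn a (Ioc s t) (μ.map Prod.fst) := Integrable.mono_measure hai hmarg
  have hai2 : IntegrableOn (fun z : ℝ × C => a z.1) {z : ℝ × C | z.1 ∈ Ioc s t} μ := by
    have h3 : IntegrableOn (a ∘ Prod.fst) (Prod.fst ⁻¹' (Ioc s t)) μ := by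
      unfold IntegrableOn at hai' ⊢
      rw [Measure.restrict_map measurable_fst measurableSet_Ioc] at hai'
      exact hai'.comp_measurable measurable_fst
    exact h3
  calc ‖∫ z in {z : ℝ × C | z.1 ∈ Ioc s t}, φ z ∂μ‖
      ≤ ∫ z in {z : ℝ × C | z.1 ∈ Ioc s t}, a z.1 ∂μ := by
        apply norm_integral_le_of_norm_le hai2
        rw [ae_restrict_iff' (measSet_Ioc s t)]
        exact hb
    _ = ∫ r in Ioc s t, a r ∂(μ.map Prod.fst) := by
        rw [setIntegral_map measurableSet_Ioc ha.aestronglyMeasurable measurable_fst.aemeasurable]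
        rfl
    _ ≤ ∫ r in Ioc s t, a r := by
        apply integral_mono_measure hmarg _ hai
        exact Filter.Eventually.of_forall fun r => ha0 r
    _ = _ := by rw [intervalIntegral.integral_of_le hst]

end Basic
end SlideAux

namespace SlideAux

set_option linter.unusedSectionVars false

open Set Metric

section Gron

theorem expint (K : ℝ) (t₀ t : ℝ) :
    |∫ r in t₀..t, K * Real.exp (2 * K * |r - t₀|)| ≤ |Real.exp (2 * K * |t - t₀|) - 1| / 2 := by
  rcases le_total t₀ t with h | h
  · have h1 : ∫ r in t₀..t, K * Real.exp (2 * K * |r - t₀|)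
        = ∫ r in t₀..t, K * Real.exp (2 * K * (r - t₀)) := by
      apply intervalIntegral.integral_congr
      intro r hr
      rw [uIcc_of_le h] at hr
      simp only [abs_of_nonneg (sub_nonneg.2 hr.1)]
    rw [h1, intervalIntegral.integral_eq_sub_of_hasDerivAt
      (f := fun r => Real.exp (2 * K * (r - t₀)) / 2)]
    · rw [abs_of_nonneg (sub_nonneg.2 h), ← abs_of_pos (show (0:ℝ) < 2 by norm_num), ← abs_div]
      simp [sub_div]
    · intro r _
      have := ((((hasDerivAt_id' r).sub_const t₀).const_mul (2 * K)).exp).div_const 2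
      refine this.congr_deriv ?_
      ring
    · exact (by fun_prop : Continuous _).intervalIntegrable _ _
  · have h1 : ∫ r in t₀..t, K * Real.exp (2 * K * |r - t₀|)
        = ∫ r in t₀..t, K * Real.exp (2 * K * (t₀ - r)) := by
      apply intervalIntegral.integral_congr
      intro r hr
      rw [uIcc_of_ge h] at hr
      simp only [abs_of_nonpos (sub_nonpos.2 hr.2), neg_sub]
    rw [h1, intervalIntegral.integral_eq_sub_of_hasDerivAt
      (f := fun r => - (Real.exp (2 * K * (t₀ - r)) / 2))]
    · rw [abs_of_nonpos (sub_nonpos.2 h), ← abs_of_pos (show (0:ℝ) < 2 by norm_num), ← abs_div,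
        ← abs_neg]
      simp [sub_div]; apply le_of_eq; congr 1; ring
    · intro r _
      have := (((((hasDerivAt_id' r).const_sub t₀).const_mul (2 * K)).exp).div_const 2).fun_neg
      convert this using 1
      ring
    · exact (by fun_prop : Continuous _).intervalIntegrable _ _

theorem expint' {K : ℝ} (hK : 0 ≤ K) (t₀ t : ℝ) :
    |∫ r in t₀..t, K * Real.exp (2 * K * |r - t₀|)| ≤ Real.exp (2 * K * |t - t₀|) / 2 := by
  refine (expint K t₀ t).trans ?_
  rw [abs_of_nonneg]
  · linarith
  · have : 0 ≤ 2 * K * |t - t₀| := by positivity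
    linarith [Real.one_le_exp this]

theorem gron {ϑ K D t₀ : ℝ} (hK : 0 ≤ K) {a : ℝ → ℝ} (ha : Continuous a)
    (ht₀ : t₀ ∈ Icc 0 ϑ) (ha0 : ∀ t, 0 ≤ a t)
    (h : ∀ t ∈ Icc 0 ϑ, a t ≤ D + |∫ r in t₀..t, K * a r|) :
    ∀ t ∈ Icc 0 ϑ, a t ≤ 2 * D * Real.exp (2 * K * ϑ) := by
  have hϑ : 0 ≤ ϑ := ht₀.1.trans ht₀.2
  have hD : 0 ≤ D := by
    have := h t₀ ht₀
    simp at this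
    exact (ha0 _).trans this
  obtain ⟨s, hs, hmax⟩ := isCompact_Icc.exists_isMaxOn (⟨t₀, ht₀⟩ : (Icc 0 ϑ).Nonempty)
    (f := fun t => Real.exp (-(2 * K * |t - t₀|)) * a t) (by fun_prop)
  set m := Real.exp (-(2 * K * |s - t₀|)) * a s with hm
  have hle : ∀ t ∈ Icc 0 ϑ, a t ≤ m * Real.exp (2 * K * |t - t₀|) := by
    intro t ht
    have h1 : Real.exp (-(2 * K * |t - t₀|)) * a t ≤ m := hmax ht
    rw [Real.exp_neg, inv_mul_le_iff₀ (Real.exp_pos _)] at h1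
    linarith
  have hm0 : 0 ≤ m := mul_nonneg (Real.exp_pos _).le (ha0 _)
  have key : a s ≤ D + m * (Real.exp (2 * K * |s - t₀|) / 2) := by
    refine (h s hs).trans ?_
    gcongr
    refine le_trans ?_ (mul_le_mul_of_nonneg_left (expint' hK t₀ s) hm0)
    rw [← abs_of_nonneg hm0, ← abs_mul, ← intervalIntegral.integral_const_mul]
    have hsub : uIoc t₀ s ⊆ Icc 0 ϑ := by
      intro r hr
      exact (convex_Icc 0 ϑ).ordConnected.uIcc_subset ht₀ hs (uIoc_subset_uIcc hr)
    rw [← Real.norm_eq_abs (∫ r in t₀..s, K * a r)]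
    refine intervalIntegral.norm_integral_le_abs_of_norm_le (μ := volume) ?_
      ((by fun_prop : Continuous fun x =>
        m * (K * Real.exp (2 * K * |x - t₀|))).intervalIntegrable _ _)
    refine (ae_restrict_mem measurableSet_uIoc).mono fun r hr => ?_
    rw [Real.norm_eq_abs, abs_of_nonneg (mul_nonneg hK (ha0 r))]
    have := mul_le_mul_of_nonneg_left (hle r (hsub hr)) hK
    linarith
  have hE1 : 1 ≤ Real.exp (2 * K * |s - t₀|) := Real.one_le_exp (by positivity)
  have has : a s ≤ 2 * D := by
    have h3 : m * Real.exp (2 * K * |s - t₀|) = a s := by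
      rw [hm, Real.exp_neg]; field_simp
    linarith
  have hm2 : m ≤ 2 * D := by
    refine le_trans ?_ has
    have : Real.exp (-(2 * K * |s - t₀|)) ≤ 1 := Real.exp_le_one_iff.2 (by
      have : 0 ≤ 2 * K * |s - t₀| := by positivity
      linarith)
    calc m ≤ 1 * a s := mul_le_mul_of_nonneg_right this (ha0 s)
      _ = a s := one_mul _
  intro t ht
  refine (hle t ht).trans ?_
  have : |t - t₀| ≤ ϑ := by
    rw [abs_le]; constructor <;> linarith [ht.1, ht.2, ht₀.1, ht₀.2]
  gcongr

end Gron

section Sol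

variable {C : Type*} [MetricSpace C] [SecondCountableTopology C] [MeasurableSpace C] [BorelSpace C]
variable {V : Type*} [NormedAddCommGroup V] [NormedSpace ℝ V] [FiniteDimensional ℝ V]
variable {ϑ : ℝ} {Λ : Set C} {μ : Measure (ℝ × C)} {h : V → C → V}

theorem incr' (hμ : Adm ϑ Λ μ) {φ : ℝ × C → V}
    (hφ : Integrable φ μ) {a : ℝ → ℝ} (ha : Continuous a) (ha0 : ∀ t, 0 ≤ a t)
    (s t : ℝ) (hb : ∀ᵐ z ∂μ, ‖φ z‖ ≤ a z.1) :
    ‖Fint μ φ t - Fint μ φ s‖ ≤ |∫ r in s..t, a r| := by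
  rcases le_total s t with hst | hst
  · exact (incr hμ hφ ha ha0 hst (hb.mono fun z hz _ => hz)).trans (le_abs_self _)
  · rw [norm_sub_rev, intervalIntegral.integral_symm, abs_neg]
    exact (incr hμ hφ ha ha0 hst (hb.mono fun z hz _ => hz)).trans (le_abs_self _)

theorem Fint_sub_fun {φ ψ : ℝ × C → V} (hφ : Integrable φ μ) (hψ : Integrable ψ μ) (t : ℝ) :
    Fint μ (fun z => φ z - ψ z) t = Fint μ φ t - Fint μ ψ t :=
  integral_sub hφ.integrableOn hψ.integrableOn

theorem incr2 (hμ : Adm ϑ Λ μ) {φ ψ : ℝ × C → V}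
    (hφ : Integrable φ μ) (hψ : Integrable ψ μ)
    {a : ℝ → ℝ} (ha : Continuous a) (ha0 : ∀ t, 0 ≤ a t)
    (s t : ℝ) (hb : ∀ᵐ z ∂μ, ‖φ z - ψ z‖ ≤ a z.1) :
    ‖(Fint μ φ t - Fint μ φ s) - (Fint μ ψ t - Fint μ ψ s)‖ ≤ |∫ r in s..t, a r| := by
  have := incr' hμ (hφ.sub hψ) ha ha0 s t hb
  have e : ∀ t, Fint μ (φ - ψ) t = Fint μ φ t - Fint μ ψ t := fun t => Fint_sub_fun hφ hψ t
  rw [e, e] at this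
  convert this using 2
  abel

theorem Fint_lip (hμ : Adm ϑ Λ μ) (hΛ : IsCompact Λ) {φ : ℝ × C → V} (hφ : Continuous φ) :
    ∃ B : ℝ, 0 ≤ B ∧ ∀ s t, ‖Fint μ φ t - Fint μ φ s‖ ≤ B * |t - s| := by
  obtain ⟨B, hB⟩ := (isCompact_Icc.prod hΛ).exists_bound_of_continuousOn
    (s := Icc 0 ϑ ×ˢ Λ) hφ.continuousOn
  refine ⟨max B 0, le_max_right _ _, fun s t => ?_⟩
  have := incr' hμ (hμ.integrable hΛ hφ) (a := fun _ => max B 0) continuous_const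
    (fun _ => le_max_right _ _) s t (by
      filter_upwards [hμ.time, hμ.supp] with z h1 h2
      exact (hB z ⟨h1, h2⟩).trans (le_max_left _ _))
  simp only [intervalIntegral.integral_const, smul_eq_mul, abs_mul] at this
  rw [abs_of_nonneg (le_max_right B 0)] at this
  linarith

theorem Fint_cont (hμ : Adm ϑ Λ μ) (hΛ : IsCompact Λ) {φ : ℝ × C → V} (hφ : Continuous φ) :
    Continuous (Fint μ φ) := by
  obtain ⟨B, hB0, hB⟩ := Fint_lip hμ hΛ hφ
  refine (LipschitzWith.of_dist_le_mul (K := ⟨B, hB0⟩) fun s t => ?_).continuous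
  rw [dist_eq_norm, Real.dist_eq]
  exact hB t s

theorem Sys.contφ (hS : Sys Λ h) {x : ℝ → V} (hx : Continuous x) :
    Continuous fun z : ℝ × C => h (x z.1) z.2 :=
  hS.cont.comp (by fun_prop : Continuous fun z : ℝ × C => (x z.1, z.2))

/-- clamp to an interval -/
def clamp (a b t : ℝ) : ℝ := max a (min b t)

theorem clamp_cont (a b : ℝ) : Continuous (clamp a b) := by unfold clamp; fun_prop

theorem clamp_mem {a b : ℝ} (hab : a ≤ b) (t : ℝ) : clamp a b t ∈ Icc a b :=
  ⟨le_max_left _ _, max_le hab (min_le_left _ _)⟩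

theorem clamp_of_mem {a b t : ℝ} (h : t ∈ Icc a b) : clamp a b t = t := by
  unfold clamp; rw [min_eq_right h.2, max_eq_right h.1]

theorem ae_ne (hμ : Adm ϑ Λ μ) (t : ℝ) : ∀ᵐ z ∂μ, z.1 ≠ t := by
  have h1 : ∀ᵐ r ∂(μ.map Prod.fst), r ≠ t := by
    refine (Measure.absolutelyContinuous_of_le
      (hμ.marg.trans Measure.restrict_le_self)).ae_le ?_
    have : ∀ᵐ r : ℝ, r ≠ t := by rw [ae_iff]; simp
    exact this
  exact ae_of_ae_map measurable_fst.aemeasurable h1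

theorem Fint_clamp' (hμ : Adm ϑ Λ μ) (_hϑ : 0 ≤ ϑ) (φ : ℝ × C → V) (t : ℝ)  :
    Fint μ φ (clamp 0 ϑ t) = Fint μ φ t := by
  unfold Fint
  apply setIntegral_congr_set
  filter_upwards [hμ.time, ae_ne hμ 0] with z hz hz0
  rw [eq_iff_iff]
  change z.1 ≤ clamp 0 ϑ t ↔ z.1 ≤ t
  unfold clamp
  rw [le_max_iff, le_min_iff]
  constructor
  · rintro (h | h)
    · exact absurd (le_antisymm h hz.1) hz0
    · exact h.2
  · exact fun h => Or.inr ⟨hz.2, h⟩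

theorem IsSol.clamp_eq (hμ : Adm ϑ Λ μ) (hϑ : 0 ≤ ϑ) {x : ℝ → V} (hx : IsSol h μ x) (t : ℝ) :
    x (clamp 0 ϑ t) = x t := by
  have := hx.eq t (clamp 0 ϑ t)
  rw [Fint_clamp' hμ hϑ, sub_self, sub_eq_zero] at this
  exact this

theorem growth (hμ : Adm ϑ Λ μ) (hS : Sys Λ h) {c : ℝ} (hc0 : 0 < c)
    (hc : ∀ x, ∀ b ∈ Λ, ‖h x b‖ ≤ c * (1 + ‖x‖)) {t₀ : ℝ} (ht₀ : t₀ ∈ Icc 0 ϑ)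
    {x : ℝ → V} (hx : IsSol h μ x) (t : ℝ) :
    ‖x t‖ ≤ 2 * (1 + ‖x t₀‖) * Real.exp (2 * c * ϑ) := by
  have hϑ : 0 ≤ ϑ := ht₀.1.trans ht₀.2
  rw [← hx.clamp_eq hμ hϑ t]
  have key := gron hc0.le (a := fun t => 1 + ‖x t‖) (D := 1 + ‖x t₀‖)
    (continuous_const.add hx.cont.norm) ht₀ (fun t => by positivity) (by
      intro t _
      have h1 := incr' hμ (hμ.integrable hS.cpt (hS.contφ hx.cont))
        (a := fun t => c * (1 + ‖x t‖)) (continuous_const.mul (continuous_const.add hx.cont.norm))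
        (fun t => by positivity) t₀ t (hμ.supp.mono fun z hz => hc _ _ hz)
      rw [← hx.eq] at h1
      have : ‖x t‖ ≤ ‖x t₀‖ + ‖x t - x t₀‖ := by
        have := norm_add_le (x t₀) (x t - x t₀)
        simpa using this
      linarith) _ (clamp_mem hϑ t)
  linarith

theorem depend (hμ : Adm ϑ Λ μ) (hS : Sys Λ h) {R : ℝ} {L : NNReal}
    (hL : ∀ b ∈ Λ, LipschitzOnWith L (fun x => h x b) (closedBall 0 R))
    {t₀ : ℝ} (ht₀ : t₀ ∈ Icc 0 ϑ)
    {x y : ℝ → V} (hx : IsSol h μ x) (hy : IsSol h μ y)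
    (hxR : ∀ t, ‖x t‖ ≤ R) (hyR : ∀ t, ‖y t‖ ≤ R) (t : ℝ) :
    ‖x t - y t‖ ≤ 2 * ‖x t₀ - y t₀‖ * Real.exp (2 * L * ϑ) := by
  have hϑ : 0 ≤ ϑ := ht₀.1.trans ht₀.2
  rw [← hx.clamp_eq hμ hϑ t, ← hy.clamp_eq hμ hϑ t]
  refine gron L.2 (a := fun t => ‖x t - y t‖) (D := ‖x t₀ - y t₀‖)
    (hx.cont.sub hy.cont).norm ht₀ (fun t => norm_nonneg _) ?_ _ (clamp_mem hϑ t)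
  intro t _
  have h1 := incr2 hμ (hμ.integrable hS.cpt (hS.contφ hx.cont))
    (hμ.integrable hS.cpt (hS.contφ hy.cont))
    (a := fun t => L * ‖x t - y t‖) (continuous_const.mul (hx.cont.sub hy.cont).norm)
    (fun t => by positivity) t₀ t (hμ.supp.mono fun z hz =>
      (hL _ hz).norm_sub_le (by simpa using hxR _) (by simpa using hyR _))
  rw [← hx.eq, ← hy.eq] at h1
  have h2 : x t - y t = (x t₀ - y t₀) + ((x t - x t₀) - (y t - y t₀)) := by abel
  have h3 := norm_add_le (x t₀ - y t₀) ((x t - x t₀) - (y t - y t₀))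
  rw [← h2] at h3
  exact h3.trans (by gcongr; exact h1)

theorem IsSol.bdd (hμ : Adm ϑ Λ μ) (hS : Sys Λ h) (hϑ : 0 ≤ ϑ) {x : ℝ → V} (hx : IsSol h μ x) :
    ∃ R, ∀ t, ‖x t‖ ≤ R := by
  obtain ⟨c, hc0, hc⟩ := hS.grow
  exact ⟨_, growth hμ hS hc0 hc (left_mem_Icc.2 hϑ) hx⟩

theorem unique (hμ : Adm ϑ Λ μ) (hS : Sys Λ h) {t₀ : ℝ} (ht₀ : t₀ ∈ Icc 0 ϑ)
    {x y : ℝ → V} (hx : IsSol h μ x) (hy : IsSol h μ y) (h0 : x t₀ = y t₀) : x = y := by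
  obtain ⟨R1, h1⟩ := hx.bdd hμ hS (ht₀.1.trans ht₀.2)
  obtain ⟨R2, h2⟩ := hy.bdd hμ hS (ht₀.1.trans ht₀.2)
  obtain ⟨L, hL⟩ := hS.lip (max R1 R2)
  ext t
  have := depend hμ hS hL ht₀ hx hy (fun t => (h1 t).trans (le_max_left _ _))
    (fun t => (h2 t).trans (le_max_right _ _)) t
  rw [h0, sub_self, norm_zero, mul_zero, zero_mul] at this
  exact sub_eq_zero.1 (norm_le_zero_iff.1 this)

theorem depend' (hμ : Adm ϑ Λ μ) (hS : Sys Λ h) {t₀ : ℝ} (ht₀ : t₀ ∈ Icc 0 ϑ)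
    (X : V → ℝ → V) (hX : ∀ a, IsSol h μ (X a)) (hX0 : ∀ a, X a t₀ = a) (R : ℝ) :
    ∃ K : NNReal, ∀ t, LipschitzOnWith K (fun a => X a t) (closedBall 0 R) := by
  obtain ⟨c, hc0, hc⟩ := hS.grow
  obtain ⟨L, hL⟩ := hS.lip (2 * (1 + R) * Real.exp (2 * c * ϑ))
  refine ⟨⟨2 * Real.exp (2 * L * ϑ), by positivity⟩, fun t => ?_⟩
  have hb : ∀ a ∈ closedBall (0 : V) R, ∀ t, ‖X a t‖ ≤ 2 * (1 + R) * Real.exp (2 * c * ϑ) := by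
    intro a ha t
    refine (growth hμ hS hc0 hc ht₀ (hX a) t).trans ?_
    rw [hX0]
    have : ‖a‖ ≤ R := by simpa using ha
    gcongr
  refine LipschitzOnWith.of_dist_le_mul fun a ha b hb' => ?_
  have := depend hμ hS hL ht₀ (hX a) (hX b) (hb a ha) (hb b hb') t
  rw [hX0, hX0] at this
  rw [dist_eq_norm, dist_eq_norm]
  refine this.trans (le_of_eq ?_)
  change _ = 2 * Real.exp (2 * L * ϑ) * ‖a - b‖
  ring

end Sol
end SlideAux

namespace SlideAux

set_option linter.unusedSectionVars false

open Set Metric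

section Exist

variable {C : Type*} [MetricSpace C] [SecondCountableTopology C] [MeasurableSpace C] [BorelSpace C]
variable {V : Type*} [NormedAddCommGroup V] [NormedSpace ℝ V] [FiniteDimensional ℝ V]
variable {ϑ : ℝ} {Λ : Set C} {μ : Measure (ℝ × C)} {h : V → C → V}

theorem Fint_bound {φ : ℝ × C → V} (hφ : Integrable φ μ) (t : ℝ) :
    ‖Fint μ φ t‖ ≤ ∫ z, ‖φ z‖ ∂μ :=
  (norm_integral_le_integral_norm _).trans
    (setIntegral_le_integral hφ.norm (Filter.Eventually.of_forall fun _ => norm_nonneg _))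

theorem exist_glob (hμ : Adm ϑ Λ μ) (hΛ : IsCompact Λ)
    (hc : Continuous fun z : V × C => h z.1 z.2) {L : NNReal}
    (hL : ∀ b ∈ Λ, LipschitzWith L (fun x => h x b)) (t₀ : ℝ) (x₀ : V) :
    ∃ x, IsSol h μ x ∧ x t₀ = x₀ := by
  have : CompleteSpace V := FiniteDimensional.complete ℝ V
  set E : ℝ → ℝ := fun t => Real.exp (2 * L * |t - t₀|) with hE
  have hEc : Continuous E := by fun_prop
  have hE0 : ∀ t, 0 < E t := fun t => Real.exp_pos _
  have hE1 : ∀ t, 1 ≤ E t := fun t => Real.one_le_exp (by positivity)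
  let φ : BoundedContinuousFunction ℝ V → ℝ × C → V := fun u z => h (E z.1 • u z.1) z.2
  have hφc : ∀ u, Continuous (φ u) := fun u =>
    hc.comp (by fun_prop : Continuous fun z : ℝ × C => (E z.1 • u z.1, z.2))
  have hφi : ∀ u, Integrable (φ u) μ := fun u => hμ.integrable hΛ (hφc u)
  let G : BoundedContinuousFunction ℝ V → ℝ → V := fun u t =>
    x₀ + (Fint μ (φ u) t - Fint μ (φ u) t₀)
  have hGc : ∀ u, Continuous (G u) := fun u =>
    continuous_const.add ((Fint_cont hμ hΛ (hφc u)).sub continuous_const)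
  let S : BoundedContinuousFunction ℝ V → BoundedContinuousFunction ℝ V := fun u =>
    BoundedContinuousFunction.ofNormedAddCommGroup (fun t => (E t)⁻¹ • G u t)
      ((hEc.inv₀ fun t => (hE0 t).ne').smul (hGc u))
      (‖x₀‖ + ((∫ z, ‖φ u z‖ ∂μ) + ∫ z, ‖φ u z‖ ∂μ)) (by
        intro t
        rw [norm_smul, norm_inv, Real.norm_of_nonneg (hE0 t).le]
        have h1 : (E t)⁻¹ ≤ 1 := inv_le_one_of_one_le₀ (hE1 t)
        have h2 : ‖G u t‖ ≤ ‖x₀‖ + ((∫ z, ‖φ u z‖ ∂μ) + ∫ z, ‖φ u z‖ ∂μ) := by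
          refine (norm_add_le _ _).trans ?_
          gcongr
          refine (norm_sub_le _ _).trans ?_
          gcongr <;> exact Fint_bound (hφi u) _
        calc (E t)⁻¹ * ‖G u t‖ ≤ 1 * ‖G u t‖ := by gcongr
          _ ≤ _ := by rw [one_mul]; exact h2)
  have hS : ContractingWith (1 / 2) S := by
    refine ⟨by rw [← NNReal.coe_lt_coe]; norm_num, LipschitzWith.of_dist_le_mul fun u v => ?_⟩
    rw [BoundedContinuousFunction.dist_le (by positivity)]
    intro t
    have h1 := incr2 hμ (hφi u) (hφi v) (a := fun t => dist u v * (L * E t)) (by fun_prop)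
      (fun t => mul_nonneg dist_nonneg (mul_nonneg L.2 (hE0 t).le)) t₀ t (by
        filter_upwards [hμ.supp] with z hz
        have := (hL _ hz).norm_sub_le (E z.1 • u z.1) (E z.1 • v z.1)
        refine this.trans ?_
        rw [← smul_sub, norm_smul, Real.norm_of_nonneg (hE0 _).le, ← dist_eq_norm]
        have := BoundedContinuousFunction.dist_coe_le_dist (f := u) (g := v) z.1
        have h3 : 0 ≤ L * E z.1 := mul_nonneg L.2 (hE0 _).le
        nlinarith)
    rw [intervalIntegral.integral_const_mul, abs_mul, abs_of_nonneg dist_nonneg] at h1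
    have h2 : |∫ r in t₀..t, (L : ℝ) * E r| ≤ E t / 2 := expint' L.coe_nonneg t₀ t
    have h3 : dist (S u t) (S v t) = (E t)⁻¹ * ‖(Fint μ (φ u) t - Fint μ (φ u) t₀)
        - (Fint μ (φ v) t - Fint μ (φ v) t₀)‖ := by
      rw [dist_eq_norm]
      change ‖(E t)⁻¹ • G u t - (E t)⁻¹ • G v t‖ = _
      rw [← smul_sub, norm_smul, norm_inv, Real.norm_of_nonneg (hE0 t).le]
      congr 2
      simp only [G]; abel
    rw [h3, inv_mul_le_iff₀ (hE0 t)]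
    refine h1.trans ((mul_le_mul_of_nonneg_left h2 dist_nonneg).trans (le_of_eq ?_))
    push_cast
    ring
  set u := ContractingWith.fixedPoint S hS with hu
  have hfix : S u = u := hS.fixedPoint_isFixedPt
  have hx : ∀ t, E t • u t = G u t := by
    intro t
    conv_lhs => rw [← hfix]
    change E t • ((E t)⁻¹ • G u t) = _
    rw [smul_inv_smul₀ (hE0 t).ne']
  refine ⟨fun t => E t • u t, ⟨hEc.smul u.continuous, fun s t => ?_⟩, ?_⟩
  · simp only [hx s, hx t]
    change (x₀ + (Fint μ (φ u) t - Fint μ (φ u) t₀)) - (x₀ + (Fint μ (φ u) s - Fint μ (φ u) t₀))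
      = Fint μ (φ u) t - Fint μ (φ u) s
    abel
  · simp only [hx]
    simp [G]

/-- radial retraction -/
def ret (R : ℝ) (x : V) : V := (R / max R ‖x‖) • x

theorem ret_norm {R : ℝ} (hR : 0 < R) (x : V) : ‖ret R x‖ ≤ R := by
  unfold ret
  have h0 : 0 < max R ‖x‖ := lt_max_of_lt_left hR
  rw [norm_smul, Real.norm_of_nonneg (by positivity), div_mul_eq_mul_div, div_le_iff₀ h0]
  gcongr; exact le_max_right _ _

theorem ret_norm' {R : ℝ} (hR : 0 < R) (x : V) : ‖ret R x‖ ≤ ‖x‖ := by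
  unfold ret
  have h0 : 0 < max R ‖x‖ := lt_max_of_lt_left hR
  rw [norm_smul, Real.norm_of_nonneg (by positivity)]
  have : R / max R ‖x‖ ≤ 1 := (div_le_one h0).2 (le_max_left _ _)
  calc _ ≤ 1 * ‖x‖ := by gcongr
    _ = _ := one_mul _

theorem ret_eq {R : ℝ} (hR : 0 < R) {x : V} (hx : ‖x‖ ≤ R) : ret R x = x := by
  unfold ret; rw [max_eq_left hx, div_self hR.ne', one_smul]

theorem ret_lip {R : ℝ} (hR : 0 < R) : LipschitzWith 2 (ret R : V → V) := by
  refine LipschitzWith.of_dist_le_mul fun x y => ?_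
  rw [dist_eq_norm, dist_eq_norm]
  unfold ret
  set a := max R ‖x‖ with ha
  set b := max R ‖y‖ with hb
  have ha0 : 0 < a := lt_max_of_lt_left hR
  have hb0 : 0 < b := lt_max_of_lt_left hR
  have e : (R / a) • x - (R / b) • y = (R / a) • (x - y) + (R / a - R / b) • y := by
    rw [smul_sub, sub_smul]; abel
  have h1 : ‖(R / a) • (x - y)‖ ≤ ‖x - y‖ := by
    rw [norm_smul, Real.norm_of_nonneg (by positivity)]
    have : R / a ≤ 1 := (div_le_one ha0).2 (le_max_left _ _)
    calc _ ≤ 1 * ‖x - y‖ := by gcongr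
      _ = _ := one_mul _
  have h2 : ‖(R / a - R / b) • y‖ ≤ ‖x - y‖ := by
    rw [norm_smul]
    have h3 : R / a - R / b = (R / a) * ((b - a) / b) := by field_simp
    have h4 : |b - a| ≤ ‖x - y‖ := by
      have h5 := abs_max_sub_max_le_max R ‖y‖ R ‖x‖
      rw [sub_self, abs_zero, max_eq_right (abs_nonneg (‖y‖ - ‖x‖))] at h5
      refine h5.trans ?_
      rw [norm_sub_rev]
      exact abs_norm_sub_norm_le _ _
    rw [h3, norm_mul, norm_div (b - a), Real.norm_of_nonneg (by positivity : 0 ≤ R / a),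
      Real.norm_of_nonneg hb0.le, Real.norm_eq_abs]
    have h6 : R / a ≤ 1 := (div_le_one ha0).2 (le_max_left _ _)
    have h7 : |b - a| / b * ‖y‖ ≤ |b - a| := by
      rw [div_mul_eq_mul_div, div_le_iff₀ hb0]
      gcongr
      exact le_max_right _ _
    calc R / a * (|b - a| / b) * ‖y‖ = R / a * (|b - a| / b * ‖y‖) := by ring
      _ ≤ 1 * |b - a| := by gcongr
      _ ≤ _ := by rw [one_mul]; exact h4
  rw [e]
  refine (norm_add_le _ _).trans ?_
  push_cast
  linarith

theorem exist (hμ : Adm ϑ Λ μ) (hS : Sys Λ h) {t₀ : ℝ} (ht₀ : t₀ ∈ Icc 0 ϑ) (x₀ : V) :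
    ∃ x, IsSol h μ x ∧ x t₀ = x₀ := by
  obtain ⟨c, hc0, hc⟩ := hS.grow
  set R := 2 * (1 + ‖x₀‖) * Real.exp (2 * c * ϑ) with hR
  have hR0 : 0 < R := by positivity
  obtain ⟨L, hL⟩ := hS.lip R
  have hL' : ∀ b ∈ Λ, LipschitzWith (L * 2) (fun x => h (ret R x) b) := by
    intro b hb
    have h1 : LipschitzOnWith (L * 2) ((fun x => h x b) ∘ ret R) univ :=
      (hL b hb).comp ((ret_lip hR0).lipschitzOnWith) (fun x _ => by
        simpa using ret_norm hR0 x)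
    exact lipschitzOnWith_univ.1 h1
  have hcont : Continuous fun z : V × C => h (ret R z.1) z.2 :=
    hS.cont.comp (((ret_lip hR0).continuous.comp continuous_fst).prodMk continuous_snd)
  have hc' : ∀ x, ∀ b ∈ Λ, ‖h (ret R x) b‖ ≤ c * (1 + ‖x‖) := fun x b hb =>
    (hc _ b hb).trans (by gcongr; exact ret_norm' hR0 x)
  have hS' : Sys Λ (fun x b => h (ret R x) b) :=
    ⟨hS.cpt, hcont, fun _ => ⟨L * 2, fun b hb => (hL' b hb).lipschitzOnWith⟩, ⟨c, hc0, hc'⟩⟩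
  obtain ⟨x, hx, hx0⟩ := exist_glob (h := fun x b => h (ret R x) b) hμ hS.cpt hcont hL' t₀ x₀
  refine ⟨x, ⟨hx.cont, fun s t => ?_⟩, hx0⟩
  have hb : ∀ t, ret R (x t) = x t := fun t => ret_eq hR0 (by
    have := growth hμ hS' hc0 hc' ht₀ hx t
    rwa [hx0] at this)
  have := hx.eq s t
  simp only [hb] at this
  exact this

end Exist
end SlideAux

namespace SlideAux

set_option linter.unusedSectionVars false

open Set Metric

section ML

variable {C : Type*} [MetricSpace C] [SecondCountableTopology C] [MeasurableSpace C] [BorelSpace C]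
variable {V : Type*} [NormedAddCommGroup V] [NormedSpace ℝ V] [FiniteDimensional ℝ V]
variable {ϑ : ℝ} {Λ : Set C} {μ : Measure (ℝ × C)} {h : V → C → V}

theorem slopeN {N : ℝ → V} (hN : Continuous N) {K : ℝ}
    (hs : ∀ t, ∀ η > (0 : ℝ), ∃ δ > (0 : ℝ), ∀ t' ∈ Ioo t (t + δ),
      ‖N t' - N t‖ ≤ (K + η) * (t' - t)) {s t : ℝ} (hst : s ≤ t) :
    ‖N t - N s‖ ≤ K * (t - s) := by
  have key : ∀ K' > K, ‖N t - N s‖ ≤ K' * (t - s) := by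
    intro K' hK'
    have := image_norm_le_of_liminf_right_slope_norm_lt_deriv_boundary (a := s) (b := t)
      (f := fun r => N r - N s) (f' := fun _ => K) (by fun_prop) (by
        intro x _ r hr
        obtain ⟨δ, hδ, H⟩ := hs x ((r - K) / 2) (by linarith)
        refine Filter.Eventually.frequently ?_
        filter_upwards [Ioo_mem_nhdsGT (show x < x + δ by linarith)] with z hz
        have hz0 : 0 < z - x := sub_pos.2 hz.1
        rw [slope_def_field, div_lt_iff₀ hz0]
        have h1 := H z hz
        have h2 : ‖N z - N s‖ - ‖N x - N s‖ ≤ ‖N z - N x‖ := by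
          have := norm_sub_norm_le (N z - N s) (N x - N s)
          simpa using this
        simp only [Function.comp]
        nlinarith)
      (B := fun r => K' * (r - s)) (B' := fun _ => K') (by simp) (by fun_prop) (by
        intro x _
        have := (((hasDerivAt_id' x).sub_const s).const_mul K').hasDerivWithinAt (s := Ici x)
        simpa using this) (fun _ _ _ => hK') (right_mem_Icc.2 hst)
    exact this
  have hc : Filter.Tendsto (fun K' => K' * (t - s)) (nhdsWithin K (Ioi K)) (nhds (K * (t - s))) :=
    ((continuous_id.mul continuous_const).tendsto K).mono_left nhdsWithin_le_nhds
  exact ge_of_tendsto hc (eventually_nhdsWithin_of_forall fun K' hK' => key K' hK')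

theorem avg_diff [MeasurableSpace V] [BorelSpace V] (ν : Measure V) [ν.IsAddHaarMeasure]
    {Ψ : V → V} {R : ℝ} {K : NNReal}
    (hK : LipschitzOnWith K Ψ (closedBall 0 (R + 1))) (x₀ : V) :
    ∀ᵐ w ∂ν, x₀ + w ∈ ball (0 : V) (R + 1) → DifferentiableAt ℝ Ψ (x₀ + w) := by
  have h1 : ∀ᵐ y ∂ν, y ∈ ball (0 : V) (R + 1) → DifferentiableWithinAt ℝ Ψ (ball 0 (R + 1)) y :=
    LipschitzOnWith.ae_differentiableWithinAt_of_mem (hK.mono ball_subset_closedBall)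
  have h2 : ∀ᵐ w ∂ν, x₀ + w ∈ ball (0 : V) (R + 1) →
      DifferentiableWithinAt ℝ Ψ (ball 0 (R + 1)) (x₀ + w) :=
    (measurePreserving_add_left ν x₀).quasiMeasurePreserving.ae h1
  filter_upwards [h2] with w hw hin
  exact (hw hin).differentiableAt (isOpen_ball.mem_nhds hin)

theorem avg_meas [MeasurableSpace V] [BorelSpace V] {ε : ℝ} (hε : 0 < ε) :
    ∃ m : Measure V, IsProbabilityMeasure m ∧ m ≪ (Measure.addHaar : Measure V) ∧
      ∀ᵐ w ∂m, ‖w‖ ≤ ε := by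
  have hb0 : (Measure.addHaar : Measure V) (ball 0 ε) ≠ 0 := (measure_ball_pos _ 0 hε).ne'
  have hb1 : (Measure.addHaar : Measure V) (ball 0 ε) ≠ ⊤ := measure_ball_lt_top.ne
  refine ⟨ProbabilityTheory.cond Measure.addHaar (ball 0 ε),
    ProbabilityTheory.cond_isProbabilityMeasure_of_finite hb0 hb1,
    ProbabilityTheory.cond_absolutelyContinuous, ?_⟩
  have : ∀ᵐ w ∂(ProbabilityTheory.cond (Measure.addHaar : Measure V) (ball 0 ε)),
      w ∈ ball (0 : V) ε := ProbabilityTheory.ae_cond_mem measurableSet_ball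
  filter_upwards [this] with w hw
  exact (by simpa using hw : ‖w‖ < ε).le

set_option maxHeartbeats 1000000 in
theorem avg {Ψ : V → V} (hΨc : Continuous Ψ) {R ε : ℝ} {K : NNReal}
    (hK : LipschitzOnWith K Ψ (closedBall 0 (R + 1))) (hε : 0 < ε) (hε2 : ε ≤ 1 / 2) :
    ∃ A : V → V, (∀ x, ‖x‖ ≤ R → ‖A x - Ψ x‖ ≤ K * ε) ∧ ∀ x₀, ‖x₀‖ ≤ R →
      ∃ D : V →L[ℝ] V, HasFDerivAt A D x₀ ∧ ∀ (p q : V) (e : ℝ),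
        (∀ w, ‖w‖ ≤ ε → DifferentiableAt ℝ Ψ (x₀ + w) → ‖fderiv ℝ Ψ (x₀ + w) p - q‖ ≤ e) →
        ‖D p - q‖ ≤ e := by
  borelize V
  have : CompleteSpace V := FiniteDimensional.complete ℝ V
  obtain ⟨m, hmp, hmac, hmem⟩ := avg_meas (V := V) hε
  have hintg : ∀ x, ‖x‖ ≤ R + 1 / 2 → Integrable (fun w => Ψ (x + w)) m := by
    intro x hx
    refine Integrable.of_bound (hΨc.comp (continuous_const.add continuous_id)).aestronglyMeasurable
      (‖Ψ x‖ + K * ε) ?_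
    filter_upwards [hmem] with w hw
    have h1 := hK.norm_sub_le (x := x + w) (y := x)
      (by simpa using (norm_add_le x w).trans (by linarith)) (by simpa using hx.trans (by linarith))
    rw [add_sub_cancel_left] at h1
    have h2 : ‖Ψ (x + w)‖ ≤ ‖Ψ x‖ + ‖Ψ (x + w) - Ψ x‖ := by
      have := norm_add_le (Ψ x) (Ψ (x + w) - Ψ x)
      simpa using this
    have h3 : (K : ℝ) * ‖w‖ ≤ K * ε := by gcongr
    linarith
  refine ⟨fun x => ∫ w, Ψ (x + w) ∂m, ?_, ?_⟩
  · intro x hx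
    have e : (∫ w, Ψ (x + w) ∂m) - Ψ x = ∫ w, (Ψ (x + w) - Ψ x) ∂m := by
      rw [integral_sub (hintg x (by linarith)) (integrable_const _)]; simp
    rw [e]
    have := norm_integral_le_of_norm_le_const (μ := m) (C := K * ε)
      (f := fun w => Ψ (x + w) - Ψ x) (by
        filter_upwards [hmem] with w hw
        have h1 := hK.norm_sub_le (x := x + w) (y := x)
          (by simpa using (norm_add_le x w).trans (by linarith))
          (by simpa using hx.trans (by linarith))
        rw [add_sub_cancel_left] at h1
        exact h1.trans (by gcongr))
    simpa using this
  · intro x₀ hx₀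
    have hR0 : 0 ≤ R := (norm_nonneg _).trans hx₀
    have hdiff : ∀ᵐ w ∂m, DifferentiableAt ℝ Ψ (x₀ + w) := by
      filter_upwards [hmac.ae_le (avg_diff Measure.addHaar hK x₀), hmem] with w hw hwe
      exact hw (by simpa using (norm_add_le x₀ w).trans_lt (by linarith))
    obtain ⟨hDi, hD⟩ := hasFDerivAt_integral_of_dominated_loc_of_lip' (μ := m) (𝕜 := ℝ)
      (F := fun x w => Ψ (x + w)) (F' := fun w => fderiv ℝ Ψ (x₀ + w)) (bound := fun _ => (K : ℝ))
      (s := ball x₀ (1 / 2)) (x₀ := x₀) (ball_mem_nhds _ (by norm_num))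
      (fun x _ => (hΨc.comp (continuous_const.add continuous_id)).aestronglyMeasurable)
      (hintg x₀ (by linarith))
      (((measurable_fderiv ℝ Ψ).comp (measurable_const_add x₀)).aestronglyMeasurable)
      (by
        filter_upwards [hmem] with w hw x hx
        have hx' : ‖x - x₀‖ < 1 / 2 := by simpa [dist_eq_norm] using hx
        have hx2 : ‖x‖ ≤ R + 1 / 2 := by
          have := norm_add_le x₀ (x - x₀)
          rw [add_sub_cancel] at this
          linarith
        have h1 := hK.norm_sub_le (x := x + w) (y := x₀ + w)
          (by simpa using (norm_add_le x w).trans (by linarith))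
          (by simpa using (norm_add_le x₀ w).trans (by linarith))
        rwa [add_sub_add_right_eq_sub] at h1)
      (integrable_const _)
      (by
        filter_upwards [hdiff] with w hw
        exact (hasFDerivAt_comp_add_right w).2 hw.hasFDerivAt)
    refine ⟨_, hD, fun p q e H => ?_⟩
    have e1 : (∫ w, fderiv ℝ Ψ (x₀ + w) ∂m) p - q = ∫ w, (fderiv ℝ Ψ (x₀ + w) p - q) ∂m := by
      rw [ContinuousLinearMap.integral_apply hDi, integral_sub (hDi.apply_continuousLinearMap p)
        (integrable_const _)]
      simp
    rw [e1]
    have := norm_integral_le_of_norm_le_const (μ := m) (C := e)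
      (f := fun w => fderiv ℝ Ψ (x₀ + w) p - q) (by
        filter_upwards [hmem, hdiff] with w hw hw2
        exact H w hw hw2)
    simpa using this

theorem ml (hμ : Adm ϑ Λ μ) (hS : Sys Λ h) (hϑ : 0 ≤ ϑ) {x : ℝ → V} (hx : IsSol h μ x)
    {Ψ : V → V} (hΨ : ∀ R : ℝ, ∃ K : NNReal, LipschitzOnWith K Ψ (closedBall 0 R))
    (hd : ∀ y, ∀ b ∈ Λ, DifferentiableAt ℝ Ψ y → fderiv ℝ Ψ y (h y b) = h (Ψ y) b) :
    IsSol h μ (fun t => Ψ (x t)) := by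
  have hΨc : Continuous Ψ := by
    rw [continuous_iff_continuousAt]
    intro y
    obtain ⟨K, hK⟩ := hΨ (‖y‖ + 1)
    exact hK.continuousOn.continuousAt (closedBall_mem_nhds_of_mem (by simp))
  obtain ⟨R, hR⟩ := hx.bdd hμ hS hϑ
  have hR0 : 0 ≤ R := (norm_nonneg _).trans (hR 0)
  obtain ⟨K, hK⟩ := hΨ (R + 1)
  set R' := ‖Ψ 0‖ + K * (R + 1) with hR'
  have hΨb : ∀ y, ‖y‖ ≤ R + 1 → ‖Ψ y‖ ≤ R' := by
    intro y hy
    have h1 := hK.norm_sub_le (x := y) (y := 0) (by simpa using hy) (by simp; linarith)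
    have h2 := norm_add_le (Ψ 0) (Ψ y - Ψ 0)
    rw [add_sub_cancel] at h2
    rw [sub_zero] at h1
    have : (K : ℝ) * ‖y‖ ≤ K * (R + 1) := by gcongr
    linarith
  obtain ⟨L, hL⟩ := hS.lip (max (R + 1) R')
  have hL1 : ∀ b ∈ Λ, ∀ y z, ‖y‖ ≤ R + 1 → ‖z‖ ≤ R + 1 → ‖h y b - h z b‖ ≤ L * ‖y - z‖ :=
    fun b hb y z hy hz => (hL b hb).norm_sub_le (by simpa using Or.inl hy) (by simpa using Or.inl hz)
  have hL2 : ∀ b ∈ Λ, ∀ y z, ‖y‖ ≤ R + 1 → ‖z‖ ≤ R + 1 →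
      ‖h (Ψ y) b - h (Ψ z) b‖ ≤ L * (K * ‖y - z‖) := by
    intro b hb y z hy hz
    refine ((hL b hb).norm_sub_le (x := Ψ y) (y := Ψ z) (by simpa using Or.inr (hΨb y hy))
      (by simpa using Or.inr (hΨb z hz))).trans ?_
    gcongr
    exact hK.norm_sub_le (by simpa using hy) (by simpa using hz)
  have hφc := hS.contφ hx.cont
  set ψ : ℝ × C → V := fun z => h (Ψ (x z.1)) z.2 with hψ
  have hψc : Continuous ψ := hS.contφ (hΨc.comp hx.cont)
  have hφi := hμ.integrable hS.cpt hφc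
  have hψi : Integrable ψ μ := hμ.integrable hS.cpt hψc
  obtain ⟨B, hB0, hB⟩ := Fint_lip hμ hS.cpt hφc
  have hxB : ∀ s t, ‖x t - x s‖ ≤ B * |t - s| := fun s t => by rw [hx.eq]; exact hB s t
  have hR1 : ∀ t, ‖x t‖ ≤ R + 1 := fun t => (hR t).trans (by linarith)
  -- the main estimate
  have key : ∀ ε : ℝ, 0 < ε → ε ≤ 1 / 2 → ∀ s t, s ≤ t →
      ‖(Ψ (x t) - Fint μ ψ t) - (Ψ (x s) - Fint μ ψ s)‖
        ≤ K * ε + K * ε + (2 * K * L * ε) * (t - s) := by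
    intro ε hε hε2 s t hst
    obtain ⟨A, hA1, hA2⟩ := avg hΨc hK hε hε2
    have hAc : Continuous fun t => A (x t) := by
      rw [continuous_iff_continuousAt]
      intro t
      obtain ⟨D, hD, -⟩ := hA2 (x t) (hR t)
      exact ContinuousAt.comp (g := A) hD.continuousAt hx.cont.continuousAt
    have hmain := slopeN (N := fun t => A (x t) - Fint μ ψ t) (K := 2 * K * L * ε)
      (hAc.sub (Fint_cont hμ hS.cpt hψc)) (by
        intro t η hη
        obtain ⟨D, hD, hDe⟩ := hA2 (x t) (hR t)
        have hDb : ∀ b ∈ Λ, ‖D (h (x t) b) - h (Ψ (x t)) b‖ ≤ 2 * K * L * ε := by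
          intro b hb
          apply hDe
          intro w hw hwd
          have hxw : ‖x t + w‖ ≤ R + 1 / 2 := (norm_add_le _ _).trans (by linarith [hR t])
          have hfd : ‖fderiv ℝ Ψ (x t + w)‖ ≤ K :=
            norm_fderiv_le_of_lipschitzOn ℝ (closedBall_mem_nhds_of_mem (by
              simp; linarith)) hK
          have e1 : fderiv ℝ Ψ (x t + w) (h (x t) b) - h (Ψ (x t)) b
              = fderiv ℝ Ψ (x t + w) (h (x t) b - h (x t + w) b)
                + (h (Ψ (x t + w)) b - h (Ψ (x t)) b) := by
            rw [map_sub, hd _ b hb hwd]; abel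
          rw [e1]
          have h1 : ‖fderiv ℝ Ψ (x t + w) (h (x t) b - h (x t + w) b)‖ ≤ K * (L * ε) := by
            refine (ContinuousLinearMap.le_opNorm _ _).trans ?_
            gcongr
            refine (hL1 b hb _ _ (hR1 t) (hxw.trans (by linarith))).trans ?_
            gcongr
            simpa using hw
          have h2 : ‖h (Ψ (x t + w)) b - h (Ψ (x t)) b‖ ≤ L * (K * ε) := by
            refine (hL2 b hb _ _ (hxw.trans (by linarith)) (hR1 t)).trans ?_
            gcongr
            simpa using hw
          refine (norm_add_le _ _).trans ?_
          linarith
        have ho := hD.isLittleO.def (c := η / (2 * (B + 1))) (by positivity)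
        have ho2 := hx.cont.continuousAt.eventually ho
        obtain ⟨δ₁, hδ₁, H1⟩ := Metric.eventually_nhds_iff.1 ho2
        set Z := ‖D‖ * (L * B) + L * (K * B) with hZ
        have hZ0 : 0 ≤ Z := by positivity
        refine ⟨min δ₁ (η / (2 * (Z + 1))), lt_min hδ₁ (by positivity), fun t' ht' => ?_⟩
        have ht0 : 0 < t' - t := sub_pos.2 ht'.1
        have htd1 : t' - t < δ₁ := by
          have := ht'.2; have := min_le_left δ₁ (η / (2 * (Z + 1))); linarith
        have htd2 : t' - t < η / (2 * (Z + 1)) := by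
          have := ht'.2; have := min_le_right δ₁ (η / (2 * (Z + 1))); linarith
        have htd3 : Z * (t' - t) ≤ η / 2 := by
          rw [lt_div_iff₀ (by positivity)] at htd2
          nlinarith
        have p1 : ‖A (x t') - A (x t) - D (x t' - x t)‖ ≤ η / 2 * (t' - t) := by
          have h1 := H1 (y := t') (by rw [Real.dist_eq, abs_of_pos ht0]; exact htd1)
          refine h1.trans ?_
          have h2 := hxB t t'
          rw [abs_of_pos ht0] at h2
          calc η / (2 * (B + 1)) * ‖x t' - x t‖ ≤ η / (2 * (B + 1)) * (B * (t' - t)) := by gcongr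
            _ ≤ η / (2 * (B + 1)) * ((B + 1) * (t' - t)) := by gcongr; linarith
            _ = η / 2 * (t' - t) := by field_simp
        have hDφ : ∀ r, Fint μ (fun z => D (h (x z.1) z.2)) r
            = D (Fint μ (fun z => h (x z.1) z.2) r) := fun r =>
          ContinuousLinearMap.integral_comp_comm D hφi.integrableOn
        have hDi : Integrable (fun z : ℝ × C => D (h (x z.1) z.2)) μ := D.integrable_comp hφi
        have p2 : ‖D (x t' - x t) - (Fint μ ψ t' - Fint μ ψ t)‖
            ≤ (2 * K * L * ε + η / 2) * (t' - t) := by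
          have h1 := incr hμ (hDi.sub hψi) (a := fun _ => 2 * K * L * ε + η / 2) continuous_const
            (fun _ => by positivity) ht'.1.le (by
              filter_upwards [hμ.supp] with z hz hzt
              have hz1 : |z.1 - t| ≤ t' - t := by
                rw [abs_of_pos (sub_pos.2 hzt.1)]; linarith [hzt.2]
              have hxx : ‖x z.1 - x t‖ ≤ B * (t' - t) :=
                (hxB t z.1).trans (by gcongr)
              have e1 : D (h (x z.1) z.2) - ψ z = D (h (x z.1) z.2 - h (x t) z.2)
                  + (D (h (x t) z.2) - h (Ψ (x t)) z.2)
                  + (h (Ψ (x t)) z.2 - h (Ψ (x z.1)) z.2) := by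
                rw [map_sub]; simp only [hψ]; abel
              have q1 : ‖D (h (x z.1) z.2 - h (x t) z.2)‖ ≤ ‖D‖ * (L * (B * (t' - t))) := by
                refine (D.le_opNorm _).trans ?_
                gcongr
                refine (hL1 _ hz _ _ (hR1 _) (hR1 _)).trans ?_
                gcongr
              have q3 : ‖h (Ψ (x t)) z.2 - h (Ψ (x z.1)) z.2‖ ≤ L * (K * (B * (t' - t))) := by
                rw [norm_sub_rev]
                refine (hL2 _ hz _ _ (hR1 _) (hR1 _)).trans ?_
                gcongr
              have q2 := hDb _ hz
              change ‖D (h (x z.1) z.2) - ψ z‖ ≤ _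
              rw [e1]
              refine (norm_add₃_le).trans ?_
              have : Z * (t' - t) = ‖D‖ * (L * (B * (t' - t))) + L * (K * (B * (t' - t))) := by
                rw [hZ]; ring
              linarith)
          have e2 : ∀ r, Fint μ ((fun z : ℝ × C => D (h (x z.1) z.2)) - ψ) r
              = D (Fint μ (fun z => h (x z.1) z.2) r) - Fint μ ψ r := fun r => by
            rw [← hDφ]; exact Fint_sub_fun hDi hψi r
          rw [e2, e2] at h1
          simp only [intervalIntegral.integral_const, smul_eq_mul] at h1
          rw [hx.eq, map_sub]
          convert h1 using 1
          · congr 1; abel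
          · ring
        have e3 : (A (x t') - Fint μ ψ t') - (A (x t) - Fint μ ψ t)
            = (A (x t') - A (x t) - D (x t' - x t))
              + (D (x t' - x t) - (Fint μ ψ t' - Fint μ ψ t)) := by abel
        rw [e3]
        refine (norm_add_le _ _).trans ((add_le_add p1 p2).trans (le_of_eq ?_))
        ring) hst
    have e4 : (Ψ (x t) - Fint μ ψ t) - (Ψ (x s) - Fint μ ψ s)
        = (-(A (x t) - Ψ (x t))) + (A (x s) - Ψ (x s))
          + ((A (x t) - Fint μ ψ t) - (A (x s) - Fint μ ψ s)) := by abel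
    rw [e4]
    refine norm_add₃_le.trans ?_
    rw [norm_neg]
    exact add_le_add (add_le_add (hA1 _ (hR t)) (hA1 _ (hR s))) hmain
  have key2 : ∀ s t, s ≤ t → Ψ (x t) - Fint μ ψ t = Ψ (x s) - Fint μ ψ s := by
    intro s t hst
    rw [← sub_eq_zero, ← norm_le_zero_iff]
    have hlim : Filter.Tendsto (fun ε : ℝ => K * ε + K * ε + (2 * K * L * ε) * (t - s))
        (nhdsWithin 0 (Ioi 0)) (nhds 0) := by
      have : Continuous (fun ε : ℝ => K * ε + K * ε + (2 * K * L * ε) * (t - s)) := by fun_prop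
      have h2 := this.tendsto 0
      simp only [mul_zero, add_zero, zero_mul] at h2
      exact h2.mono_left nhdsWithin_le_nhds
    refine ge_of_tendsto hlim ?_
    filter_upwards [Ioo_mem_nhdsGT (show (0 : ℝ) < 1 / 2 by norm_num)] with ε hε
    exact key ε hε.1 hε.2.le s t hst
  refine ⟨hΨc.comp hx.cont, fun s t => ?_⟩
  change Ψ (x t) - Ψ (x s) = Fint μ ψ t - Fint μ ψ s
  have h3 : Ψ (x t) - Fint μ ψ t = Ψ (x s) - Fint μ ψ s := by
    rcases le_total s t with hst | hst
    · exact key2 s t hst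
    · exact (key2 t s hst).symm
  rw [sub_eq_sub_iff_add_eq_add] at h3 ⊢
  rw [h3]; abel

end ML
end SlideAux

namespace SlideAux

set_option linter.unusedSectionVars false

open Set Metric

section TimeChange

variable {C : Type*} [MetricSpace C] [SecondCountableTopology C] [MeasurableSpace C] [BorelSpace C]
variable {D : Type*} [MetricSpace D] [SecondCountableTopology D] [MeasurableSpace D] [BorelSpace D]
variable {V : Type*} [NormedAddCommGroup V] [NormedSpace ℝ V] [FiniteDimensional ℝ V]
variable {ϑ : ℝ} {Λ : Set C} {μ : Measure (ℝ × C)} {h : V → C → V}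

theorem IsSlide.adm {μ : Measure (ℝ × C)} (hμ : IsSlideControl ϑ Λ μ) : Adm ϑ Λ μ := by
  refine ⟨hμ.1.le, ?_⟩
  have : ∀ᵐ z ∂μ, z ∈ Icc 0 ϑ ×ˢ Λ := hμ.2
  filter_upwards [this] with z hz using hz.2

theorem stopSol (hμ : Adm ϑ Λ μ) (hS : Sys Λ h) {a b : ℝ} (hab : a ≤ b) {x : ℝ → V}
    (hx : IsSol h μ x) :
    IsSol h (μ.restrict {z : ℝ × C | z.1 ∈ Ioc a b}) (fun t => x (clamp a b t)) := by
  refine ⟨hx.cont.comp (clamp_cont a b), ?_⟩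
  have hi : Integrable (fun z : ℝ × C => h (x z.1) z.2) μ :=
    hμ.integrable hS.cpt (hS.contφ hx.cont)
  have key : ∀ t, Fint (μ.restrict {z : ℝ × C | z.1 ∈ Ioc a b})
      (fun z => h (x (clamp a b z.1)) z.2) t
      = Fint μ (fun z => h (x z.1) z.2) (clamp a b t) - Fint μ (fun z => h (x z.1) z.2) a := by
    intro t
    rw [Fint_sub hi (clamp_mem hab t).1]
    unfold Fint
    rw [Measure.restrict_restrict (measSet_le t)]
    have e : {z : ℝ × C | z.1 ≤ t} ∩ {z : ℝ × C | z.1 ∈ Ioc a b}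
        = {z : ℝ × C | z.1 ∈ Ioc a (clamp a b t)} := by
      ext z
      simp only [mem_inter_iff, mem_ofPred_eq, mem_Ioc, clamp, le_max_iff, le_min_iff]
      constructor
      · rintro ⟨h1, h2, h3⟩; exact ⟨h2, Or.inr ⟨h3, h1⟩⟩
      · rintro ⟨h2, h3 | h3⟩
        · exact absurd h2 (not_lt.2 h3)
        · exact ⟨h3.2, h2, h3.1⟩
    rw [e]
    refine setIntegral_congr_fun (measSet_Ioc _ _) ?_
    intro z hz
    have hz' : z.1 ∈ Icc a b := ⟨hz.1.le, hz.2.trans (clamp_mem hab t).2⟩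
    simp only [clamp_of_mem hz']
  intro s t
  rw [key, key, hx.eq]
  abel

/-- Elapsed mass. -/
def clk (μ : Measure (ℝ × C)) (t : ℝ) : ℝ := μ.real {z : ℝ × C | z.1 ≤ t}

theorem clk_mono (hμ : Adm ϑ Λ μ) : Monotone (clk μ) := by
  have := hμ.finite
  intro s t hst
  exact measureReal_mono (fun z hz => le_trans hz hst)

theorem clk_sub (hμ : Adm ϑ Λ μ) {s t : ℝ} (hst : s ≤ t) :
    clk μ t - clk μ s = μ.real {z : ℝ × C | z.1 ∈ Ioc s t} := by
  have := hμ.finite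
  have e := Fint_sub (μ := μ) (φ := fun _ => (1 : ℝ)) (integrable_const _) hst
  simpa [Fint, clk] using e

theorem clk_cont (hμ : Adm ϑ Λ μ) (hΛ : IsCompact Λ) : Continuous (clk μ) := by
  have e := Fint_cont (φ := fun _ => (1 : ℝ)) hμ hΛ continuous_const
  have : clk μ = Fint μ (fun _ => (1 : ℝ)) := by
    ext t; simp [Fint, clk]
  rwa [this]

theorem clk_zero (hμ : Adm ϑ Λ μ) {t : ℝ} (ht : ∀ᵐ z ∂μ, t ≤ z.1) : clk μ t = 0 := by
  have : μ {z : ℝ × C | z.1 ≤ t} = 0 := by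
    have h1 : ∀ᵐ z ∂μ, ¬ z.1 ≤ t := by
      filter_upwards [ht, ae_ne hμ t] with z h1 h2 h3
      exact h2 (le_antisymm h3 h1)
    simpa [ae_iff] using h1
  simp [clk, Measure.real, this]

theorem clk_top {t : ℝ} (ht : ∀ᵐ z ∂μ, z.1 ≤ t) : clk μ t = μ.real univ := by
  have : {z : ℝ × C | z.1 ≤ t} =ᵐ[μ] univ := by
    rw [Filter.eventuallyEq_univ]
    exact ht
  simp only [clk, Measure.real, measure_congr this]

theorem clk_le_top (hμ : Adm ϑ Λ μ) (t : ℝ) : clk μ t ≤ μ.real univ := by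
  have := hμ.finite
  exact measureReal_mono (subset_univ _)

theorem clk_nonneg (t : ℝ) : 0 ≤ clk μ t := measureReal_nonneg

theorem clk_map (hμ : Adm ϑ Λ μ) (hΛ : IsCompact Λ) (hϑ : 0 ≤ ϑ) (a : ℝ) :
    μ.map (fun z => a + clk μ z.1) = volume.restrict (Icc a (a + μ.real univ)) := by
  have := hμ.finite
  have hcc := clk_cont hμ hΛ
  have hm : Measurable (fun z : ℝ × C => a + clk μ z.1) :=
    (continuous_const.add (hcc.comp continuous_fst)).measurable
  have : IsFiniteMeasure (μ.map (fun z => a + clk μ z.1)) := Measure.isFiniteMeasure_map _ _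
  refine Measure.ext_of_Iic _ _ fun c => ?_
  rw [Measure.map_apply hm measurableSet_Iic, Measure.restrict_apply measurableSet_Iic]
  have h0 : clk μ 0 = 0 := clk_zero hμ (by filter_upwards [hμ.time] with z hz using hz.1)
  have h1 : clk μ ϑ = μ.real univ := clk_top (by filter_upwards [hμ.time] with z hz using hz.2)
  rcases lt_or_ge c a with hca | hca
  · have e1 : (fun z : ℝ × C => a + clk μ z.1) ⁻¹' Iic c = ∅ := by
      ext z
      simp only [mem_preimage, mem_Iic, mem_empty_iff_false, iff_false, not_le]
      have := clk_nonneg (μ := μ) z.1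
      linarith
    have e2 : Iic c ∩ Icc a (a + μ.real univ) = ∅ := by
      ext z
      simp only [mem_inter_iff, mem_Iic, mem_Icc, mem_empty_iff_false, iff_false]
      rintro ⟨h1, h2, -⟩
      linarith
    rw [e1, e2]; simp
  rcases lt_or_ge c (a + μ.real univ) with hcb | hcb
  · have hcpt : IsCompact {s | s ∈ Icc 0 ϑ ∧ a + clk μ s ≤ c} :=
      isCompact_Icc.inter_right (isClosed_le (continuous_const.add hcc) continuous_const)
    obtain ⟨t, ⟨ht, htc⟩, htm⟩ := hcpt.exists_isGreatest ⟨0, ⟨le_rfl, hϑ⟩, by rw [h0]; simpa⟩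
    have hteq : a + clk μ t = c := by
      obtain ⟨s, hs, hsc⟩ := intermediate_value_Icc ht.2
        (continuous_const.add hcc : Continuous fun t => a + clk μ t).continuousOn
        (show c ∈ Icc (a + clk μ t) (a + clk μ ϑ) from ⟨htc, by rw [h1]; exact hcb.le⟩)
      have : s ≤ t := htm ⟨⟨ht.1.trans hs.1, hs.2⟩, hsc.le⟩
      have : s = t := le_antisymm this hs.1
      rw [← this]; exact hsc
    have e1 : (fun z : ℝ × C => a + clk μ z.1) ⁻¹' Iic c =ᵐ[μ] {z : ℝ × C | z.1 ≤ t} := by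
      filter_upwards [hμ.time] with z hz
      apply propext
      constructor
      · intro h; exact htm ⟨hz, h⟩
      · intro h
        change a + clk μ z.1 ≤ c
        have := clk_mono hμ h
        linarith
    have e2 : Iic c ∩ Icc a (a + μ.real univ) = Icc a c := by
      ext z
      simp only [mem_inter_iff, mem_Iic, mem_Icc]
      constructor
      · rintro ⟨h1, h2, -⟩; exact ⟨h2, h1⟩
      · rintro ⟨h1, h2⟩; exact ⟨h2, h1, h2.trans hcb.le⟩
    rw [measure_congr e1, e2, Real.volume_Icc, ← hteq, add_sub_cancel_left]
    simp [clk]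
  · have e1 : (fun z : ℝ × C => a + clk μ z.1) ⁻¹' Iic c = univ := by
      ext z
      simp only [mem_preimage, mem_Iic, mem_univ, iff_true]
      have := clk_le_top hμ z.1
      linarith
    have e2 : Iic c ∩ Icc a (a + μ.real univ) = Icc a (a + μ.real univ) := by
      rw [inter_eq_right]
      intro z hz; exact hz.2.trans hcb
    rw [e1, e2, Real.volume_Icc, add_sub_cancel_left]
    simp

theorem timeChange (hμ : Adm ϑ Λ μ) (hΛ : IsCompact Λ) (hϑ : 0 ≤ ϑ) {Λ' : Set D}
    (hΛ' : IsCompact Λ') {π : C → D} (hπc : Continuous π) (hπ : ∀ b ∈ Λ, π b ∈ Λ')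
    {b₀ : D} (hb₀ : b₀ ∈ Λ') {a : ℝ} (ha : 0 ≤ a) (haϑ : a + μ.real univ ≤ ϑ) :
    ∃ σ : Measure (ℝ × D), IsSlideControl ϑ Λ' σ ∧ ∀ k : V → D → V, Sys Λ' k →
      ∀ x : ℝ → V, IsSol k σ x →
        IsSol (fun y b => k y (π b)) μ (fun t => x (a + clk μ t)) := by
  have := hμ.finite
  have hcc := clk_cont hμ hΛ
  set J := Icc a (a + μ.real univ) with hJ
  have hJsub : J ⊆ Icc 0 ϑ := Icc_subset_Icc ha haϑ
  set T : ℝ × C → ℝ × D := fun z => (a + clk μ z.1, π z.2) with hT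
  have hTc : Continuous T :=
    (continuous_const.add (hcc.comp continuous_fst)).prodMk (hπc.comp continuous_snd)
  set ν := μ.map T with hν
  set κ : Measure (ℝ × D) := (volume.restrict (Icc 0 ϑ \ J)).map (fun t => (t, b₀)) with hκ
  have hmk : Measurable (fun t : ℝ => (t, b₀)) := by fun_prop
  have hν1 : ν.map Prod.fst = volume.restrict J := by
    rw [hν, Measure.map_map measurable_fst hTc.measurable]
    exact clk_map hμ hΛ hϑ a
  have hκ1 : κ.map Prod.fst = volume.restrict (Icc 0 ϑ \ J) := by
    rw [hκ, Measure.map_map measurable_fst hmk]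
    exact Measure.map_id
  have hsl : IsSlideControl ϑ Λ' (ν + κ) := by
    refine ⟨?_, ?_⟩
    · rw [Measure.map_add _ _ measurable_fst, hν1, hκ1]
      have := Measure.restrict_inter_add_sdiff (μ := volume) (Icc 0 ϑ) (t := J) measurableSet_Icc
      rwa [inter_eq_right.2 hJsub] at this
    · have hms : MeasurableSet (Icc 0 ϑ ×ˢ Λ')ᶜ :=
        (measurableSet_Icc.prod hΛ'.isClosed.measurableSet).compl
      rw [Measure.add_apply, hν, hκ, Measure.map_apply hTc.measurable hms,
        Measure.map_apply hmk hms, add_eq_zero]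
      constructor
      · have : ∀ᵐ z ∂μ, T z ∈ Icc 0 ϑ ×ˢ Λ' := by
          filter_upwards [hμ.supp] with z hz
          have h1 := clk_nonneg (μ := μ) z.1
          have h2 := clk_le_top hμ z.1
          exact ⟨⟨by simp only [hT]; linarith, by simp only [hT]; linarith⟩, hπ _ hz⟩
        exact this
      · have : ∀ᵐ t ∂(volume.restrict (Icc 0 ϑ \ J)), (t, b₀) ∈ Icc 0 ϑ ×ˢ Λ' := by
          filter_upwards [ae_restrict_mem (measurableSet_Icc.diff measurableSet_Icc)] with t ht
          exact ⟨ht.1, hb₀⟩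
        exact this
  refine ⟨ν + κ, hsl, fun k hk x hx => ⟨hx.cont.comp (continuous_const.add hcc), ?_⟩⟩
  set ψ : ℝ × D → V := fun z => k (x z.1) z.2 with hψ
  have hψc : Continuous ψ := hk.contφ hx.cont
  have hadm := IsSlide.adm hsl
  have hψi : Integrable ψ (ν + κ) := hadm.integrable hΛ' hψc
  have hψν : Integrable ψ ν := hψi.left_of_add_measure
  have hψκ : Integrable ψ κ := hψi.right_of_add_measure
  have hFadd : ∀ t, Fint (ν + κ) ψ t = Fint ν ψ t + Fint κ ψ t := by
    intro t
    unfold Fint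
    rw [Measure.restrict_add, integral_add_measure hψν.integrableOn hψκ.integrableOn]
  have hmemJ : ∀ t, a + clk μ t ∈ J := by
    intro t
    have h1 := clk_nonneg (μ := μ) t
    have h2 := clk_le_top hμ t
    exact ⟨by linarith, by linarith⟩
  have hκae : ∀ᵐ z ∂κ, z.1 ∉ J := by
    have h1 : ∀ᵐ t ∂(κ.map Prod.fst), t ∉ J := by
      rw [hκ1]
      filter_upwards [ae_restrict_mem (measurableSet_Icc.diff measurableSet_Icc)] with t ht
      exact ht.2
    exact ae_of_ae_map measurable_fst.aemeasurable h1
  have hκF : ∀ s ∈ J, ∀ t ∈ J, Fint κ ψ s = Fint κ ψ t := by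
    intro s hs t ht
    unfold Fint
    refine setIntegral_congr_set ?_
    filter_upwards [hκae] with z hz
    apply propext
    change z.1 ≤ s ↔ z.1 ≤ t
    by_cases h1 : z.1 < a
    · exact ⟨fun _ => h1.le.trans ht.1, fun _ => h1.le.trans hs.1⟩
    · have h2 : a + μ.real univ < z.1 := by
        by_contra h3
        exact hz ⟨not_lt.1 h1, not_lt.1 h3⟩
      exact ⟨fun h => absurd (h.trans hs.2) (not_le.2 h2), fun h => absurd (h.trans ht.2) (not_le.2 h2)⟩
  have hνF : ∀ t, Fint ν ψ (a + clk μ t) = Fint μ (fun z => ψ (T z)) t := by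
    intro t
    unfold Fint
    rw [hν, setIntegral_map (measSet_le _) hψc.aestronglyMeasurable hTc.measurable.aemeasurable]
    refine setIntegral_congr_set ?_
    have h1 : ∀ᵐ z ∂μ, a + clk μ z.1 ≠ a + clk μ t := by
      have h2 : ∀ᵐ r ∂(μ.map (fun z => a + clk μ z.1)), r ≠ a + clk μ t := by
        rw [clk_map hμ hΛ hϑ a]
        exact ae_restrict_of_ae (Measure.ae_ne volume _)
      exact ae_of_ae_map (continuous_const.add (hcc.comp continuous_fst)).measurable.aemeasurable h2
    filter_upwards [h1] with z hz
    apply propext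
    change a + clk μ z.1 ≤ a + clk μ t ↔ z.1 ≤ t
    constructor
    · intro h
      by_contra h3
      have := clk_mono hμ (not_le.1 h3).le
      exact hz (le_antisymm h (by linarith))
    · intro h
      have := clk_mono hμ h
      linarith
  intro s t
  have e := hx.eq (a + clk μ s) (a + clk μ t)
  change _ = Fint (ν + κ) ψ _ - Fint (ν + κ) ψ _ at e
  rw [hFadd, hFadd, hκF _ (hmemJ t) _ (hmemJ s), hνF, hνF] at e
  rw [e]
  abel_nf
  rfl

theorem diag {μ₁ μ₀ : Measure (ℝ × C)} (h1 : Adm ϑ Λ μ₁) (h0 : Adm ϑ Λ μ₀)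
    {k₁ k₀ : V → C → V} (hk1 : Sys Λ k₁) (hk0 : Sys Λ k₀)
    {W : ℝ → ℝ → V} (hW : Continuous fun z : ℝ × ℝ => W z.1 z.2)
    (hW1 : ∀ s, IsSol k₁ μ₁ (fun t => W s t)) (hW0 : ∀ t, IsSol k₀ μ₀ (fun s => W s t))
    (he1 : ∀ᵐ z ∂μ₁, ∀ y, h y z.2 = k₁ y z.2) (he0 : ∀ᵐ z ∂μ₀, ∀ y, h y z.2 = k₀ y z.2) :
    IsSol h (μ₁ + μ₀) (fun t => W t t) := by
  have hwc : Continuous fun t => W t t := hW.comp (continuous_id.prodMk continuous_id)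
  set φ₁ : ℝ × C → V := fun z => k₁ (W z.1 z.1) z.2 with hφ₁
  set φ₀ : ℝ × C → V := fun z => k₀ (W z.1 z.1) z.2 with hφ₀
  have hphiA : Continuous φ₁ := hk1.contφ hwc
  have hphiB : Continuous φ₀ := hk0.contφ hwc
  have hphiC : Integrable φ₁ μ₁ := h1.integrable hk1.cpt hphiA
  have hphiD : Integrable φ₀ μ₀ := h0.integrable hk0.cpt hphiB
  have near : ∀ k : V → C → V, Sys Λ k → ∀ t, ∀ η > (0 : ℝ), ∃ δ > (0 : ℝ), ∀ s r,
      |s - t| < δ → |r - t| < δ → ∀ b ∈ Λ, ‖k (W s r) b - k (W t t) b‖ ≤ η := by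
    intro k hk t η hη
    obtain ⟨L, hL⟩ := hk.lip (‖W t t‖ + 1)
    obtain ⟨δ, hδ, H⟩ := Metric.continuousAt_iff.1 (hW.continuousAt (x := (t, t)))
      (min 1 (η / (L + 1))) (by positivity)
    refine ⟨δ, hδ, fun s r hs hr b hb => ?_⟩
    have h2 := H (x := (s, r)) (by
      rw [Prod.dist_eq]; simp only [Real.dist_eq]; exact max_lt hs hr)
    rw [dist_eq_norm] at h2
    have h3 : ‖W s r‖ ≤ ‖W t t‖ + 1 := by
      have := norm_add_le (W t t) (W s r - W t t)
      rw [add_sub_cancel] at this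
      have := h2.trans_le (min_le_left _ _)
      simp only at this
      linarith
    refine ((hL b hb).norm_sub_le (x := W s r) (y := W t t) (by simpa using h3) (by simp)).trans ?_
    have h4 := h2.le.trans (min_le_right _ _)
    simp only at h4
    calc (L : ℝ) * ‖W s r - W t t‖ ≤ (L + 1) * (η / (L + 1)) := by gcongr; linarith
      _ = η := by field_simp
  have hconst : ∀ s t, s ≤ t → ‖(W t t - Fint μ₁ φ₁ t - Fint μ₀ φ₀ t)
      - (W s s - Fint μ₁ φ₁ s - Fint μ₀ φ₀ s)‖ ≤ 0 * (t - s) := by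
    intro s t hst
    refine slopeN (N := fun t => W t t - Fint μ₁ φ₁ t - Fint μ₀ φ₀ t) (K := 0)
      ((hwc.sub (Fint_cont h1 hk1.cpt hphiA)).sub (Fint_cont h0 hk0.cpt hphiB)) ?_ hst
    intro t η hη
    obtain ⟨δ₁, hδ₁, H1⟩ := near k₁ hk1 t (η / 4) (by linarith)
    obtain ⟨δ₀, hδ₀, H0⟩ := near k₀ hk0 t (η / 4) (by linarith)
    refine ⟨min δ₁ δ₀, lt_min hδ₁ hδ₀, fun t' ht' => ?_⟩
    have ht0 : 0 < t' - t := sub_pos.2 ht'.1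
    have hd1 : t' - t < δ₁ := by have := ht'.2; have := min_le_left δ₁ δ₀; linarith
    have hd0 : t' - t < δ₀ := by have := ht'.2; have := min_le_right δ₁ δ₀; linarith
    have hψ1 : Integrable (fun z : ℝ × C => k₁ (W t z.1) z.2) μ₁ :=
      h1.integrable hk1.cpt (hk1.contφ (hW1 t).cont)
    have hψ0 : Integrable (fun z : ℝ × C => k₀ (W z.1 t') z.2) μ₀ :=
      h0.integrable hk0.cpt (hk0.contφ (hW0 t').cont)
    have q1 := incr h1 (hψ1.sub hphiC) (a := fun _ => η / 2) continuous_const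
      (fun _ => by positivity) ht'.1.le (by
        filter_upwards [h1.supp] with z hz hzt
        have hz1 : |z.1 - t| < δ₁ := by
          rw [abs_of_pos (sub_pos.2 hzt.1)]; linarith [hzt.2]
        have a1 := H1 t z.1 (by simpa using hδ₁) hz1 z.2 hz
        have a2 := H1 z.1 z.1 hz1 hz1 z.2 hz
        have e : k₁ (W t z.1) z.2 - φ₁ z = (k₁ (W t z.1) z.2 - k₁ (W t t) z.2)
            - (k₁ (W z.1 z.1) z.2 - k₁ (W t t) z.2) := by simp only [hφ₁]; abel
        change ‖k₁ (W t z.1) z.2 - φ₁ z‖ ≤ η / 2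
        rw [e]
        exact (norm_sub_le _ _).trans (by linarith))
    have q0 := incr h0 (hψ0.sub hphiD) (a := fun _ => η / 2) continuous_const
      (fun _ => by positivity) ht'.1.le (by
        filter_upwards [h0.supp] with z hz hzt
        have hz1 : |z.1 - t| < δ₀ := by
          rw [abs_of_pos (sub_pos.2 hzt.1)]; linarith [hzt.2]
        have a1 := H0 z.1 t' hz1 (by rw [abs_of_pos ht0]; exact hd0) z.2 hz
        have a2 := H0 z.1 z.1 hz1 hz1 z.2 hz
        have e : k₀ (W z.1 t') z.2 - φ₀ z = (k₀ (W z.1 t') z.2 - k₀ (W t t) z.2)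
            - (k₀ (W z.1 z.1) z.2 - k₀ (W t t) z.2) := by simp only [hφ₀]; abel
        change ‖k₀ (W z.1 t') z.2 - φ₀ z‖ ≤ η / 2
        rw [e]
        exact (norm_sub_le _ _).trans (by linarith))
    have e1 : ∀ r, Fint μ₁ ((fun z : ℝ × C => k₁ (W t z.1) z.2) - φ₁) r
        = Fint μ₁ (fun z : ℝ × C => k₁ (W t z.1) z.2) r - Fint μ₁ φ₁ r :=
      fun r => Fint_sub_fun hψ1 hphiC r
    have e0 : ∀ r, Fint μ₀ ((fun z : ℝ × C => k₀ (W z.1 t') z.2) - φ₀) r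
        = Fint μ₀ (fun z : ℝ × C => k₀ (W z.1 t') z.2) r - Fint μ₀ φ₀ r :=
      fun r => Fint_sub_fun hψ0 hphiD r
    rw [e1, e1] at q1
    rw [e0, e0] at q0
    simp only [intervalIntegral.integral_const, smul_eq_mul] at q1 q0
    have w1 := (hW1 t).eq t t'
    have w0 := (hW0 t').eq t t'
    have e : (W t' t' - Fint μ₁ φ₁ t' - Fint μ₀ φ₀ t') - (W t t - Fint μ₁ φ₁ t - Fint μ₀ φ₀ t)
        = (((W t t' - W t t) - (Fint μ₁ φ₁ t' - Fint μ₁ φ₁ t)))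
          + ((W t' t' - W t t') - (Fint μ₀ φ₀ t' - Fint μ₀ φ₀ t)) := by abel
    rw [e, w1, w0]
    refine (norm_add_le _ _).trans ?_
    have g1 : ∀ a b c d : V, (a - b) - (c - d) = (a - c) - (b - d) := fun a b c d => by abel
    rw [g1, g1 (Fint μ₀ _ t')]
    linarith
  have hcon2 : ∀ s t, W t t - Fint μ₁ φ₁ t - Fint μ₀ φ₀ t
      = W s s - Fint μ₁ φ₁ s - Fint μ₀ φ₀ s := by
    have : ∀ s t, s ≤ t → W t t - Fint μ₁ φ₁ t - Fint μ₀ φ₀ t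
      = W s s - Fint μ₁ φ₁ s - Fint μ₀ φ₀ s := by
      intro s t hst
      have := hconst s t hst
      rw [zero_mul, norm_le_zero_iff, sub_eq_zero] at this
      exact this
    intro s t
    rcases le_total s t with hst | hst
    · exact this s t hst
    · exact (this t s hst).symm
  have hF : ∀ t, Fint (μ₁ + μ₀) (fun z => h (W z.1 z.1) z.2) t = Fint μ₁ φ₁ t + Fint μ₀ φ₀ t := by
    intro t
    have a1 : (fun z : ℝ × C => h (W z.1 z.1) z.2) =ᵐ[μ₁] φ₁ := by
      filter_upwards [he1] with z hz using hz _
    have a0 : (fun z : ℝ × C => h (W z.1 z.1) z.2) =ᵐ[μ₀] φ₀ := by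
      filter_upwards [he0] with z hz using hz _
    unfold Fint
    rw [Measure.restrict_add, integral_add_measure (hphiC.congr a1.symm).integrableOn
      (hphiD.congr a0.symm).integrableOn, integral_congr_ae (ae_restrict_of_ae a1),
      integral_congr_ae (ae_restrict_of_ae a0)]
  refine ⟨hwc, fun s t => ?_⟩
  rw [hF, hF]
  have := hcon2 s t
  rw [← sub_eq_zero] at this ⊢
  rw [← this]; abel

end TimeChange
end SlideAux

namespace SlideAux

set_option linter.unusedSectionVars false

open Set Metric

section Conv

variable {C : Type*} [MetricSpace C] [SecondCountableTopology C] [MeasurableSpace C] [BorelSpace C]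
variable {D : Type*} [MetricSpace D] [SecondCountableTopology D] [MeasurableSpace D] [BorelSpace D]
variable {V : Type*} [NormedAddCommGroup V] [NormedSpace ℝ V] [FiniteDimensional ℝ V]
variable {ϑ : ℝ} {Λ : Set C} {μ : Measure (ℝ × C)} {h : V → C → V}

theorem setInt (hμ : Adm ϑ Λ μ) (hS : Sys Λ h) {x x' : ℝ → V} (hx' : Continuous x')
    (hxx : ∀ t ∈ Icc 0 ϑ, x t = x' t) {s t : ℝ} (hst : s ≤ t) (hs : 0 ≤ s) (ht : t ≤ ϑ) :
    ∫ z in Icc s t ×ˢ Λ, h (x z.1) z.2 ∂μ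
      = Fint μ (fun z => h (x' z.1) z.2) t - Fint μ (fun z => h (x' z.1) z.2) s := by
  have hi : Integrable (fun z : ℝ × C => h (x' z.1) z.2) μ :=
    hμ.integrable hS.cpt (hS.contφ hx')
  rw [Fint_sub hi hst]
  have hms : MeasurableSet (Icc s t ×ˢ Λ) :=
    measurableSet_Icc.prod hS.cpt.isClosed.measurableSet
  have e1 : ∫ z in Icc s t ×ˢ Λ, h (x z.1) z.2 ∂μ = ∫ z in Icc s t ×ˢ Λ, h (x' z.1) z.2 ∂μ := by
    refine setIntegral_congr_fun hms ?_
    intro z hz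
    simp only
    rw [hxx z.1 ⟨hs.trans hz.1.1, hz.1.2.trans ht⟩]
  rw [e1]
  refine setIntegral_congr_set ?_
  filter_upwards [ae_ne hμ s, hμ.supp] with z h1 h2
  apply propext
  change z ∈ Icc s t ×ˢ Λ ↔ z.1 ∈ Ioc s t
  constructor
  · intro hz; exact ⟨lt_of_le_of_ne hz.1.1 (Ne.symm h1), hz.1.2⟩
  · intro hz; exact ⟨⟨hz.1.le, hz.2⟩, h2⟩

theorem toSol {n : ℕ} {h : EuclideanSpace ℝ (Fin n) → C → EuclideanSpace ℝ (Fin n)}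
    (hμ : IsSlideControl ϑ Λ μ) (hS : Sys Λ h) {t₀ : ℝ} (ht₀ : t₀ ∈ Icc 0 ϑ)
    {x₀ : EuclideanSpace ℝ (Fin n)} {x : ℝ → EuclideanSpace ℝ (Fin n)}
    (hx : IsMotion ϑ Λ h μ t₀ x₀ x) : IsSol h μ (fun t => x (clamp 0 ϑ t)) := by
  obtain ⟨hc, h0, hr, hl⟩ := hx
  have hϑ : 0 ≤ ϑ := ht₀.1.trans ht₀.2
  have hA := IsSlide.adm hμ
  have hcc : Continuous fun t => x (clamp 0 ϑ t) :=
    hc.comp_continuous (clamp_cont 0 ϑ) (fun t => clamp_mem hϑ t)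
  have hxx : ∀ t ∈ Icc 0 ϑ, x t = x (clamp 0 ϑ t) := fun t ht => by rw [clamp_of_mem ht]
  have key : ∀ t ∈ Icc 0 ϑ, x t = x₀ + (Fint μ (fun z => h (x (clamp 0 ϑ z.1)) z.2) t
      - Fint μ (fun z => h (x (clamp 0 ϑ z.1)) z.2) t₀) := by
    intro t ht
    rcases le_total t₀ t with h1 | h1
    · rw [hr t ht h1, setInt hA hS hcc hxx h1 ht₀.1 ht.2]
    · rw [hl t ht h1, setInt hA hS hcc hxx h1 ht.1 ht₀.2]
      abel
  refine ⟨hcc, fun s t => ?_⟩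
  rw [key _ (clamp_mem hϑ t), key _ (clamp_mem hϑ s), Fint_clamp' hA hϑ, Fint_clamp' hA hϑ]
  abel

theorem ofSol {n : ℕ} {h : EuclideanSpace ℝ (Fin n) → C → EuclideanSpace ℝ (Fin n)}
    (hμ : IsSlideControl ϑ Λ μ) (hS : Sys Λ h) {t₀ : ℝ} (ht₀ : t₀ ∈ Icc 0 ϑ)
    {x : ℝ → EuclideanSpace ℝ (Fin n)}
    (hx : IsSol h μ x) : IsMotion ϑ Λ h μ t₀ (x t₀) x := by
  have hA := IsSlide.adm hμ
  refine ⟨hx.cont.continuousOn, rfl, fun t ht h1 => ?_, fun t ht h1 => ?_⟩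
  · rw [setInt hA hS hx.cont (fun _ _ => rfl) h1 ht₀.1 ht.2, ← hx.eq]; abel
  · rw [setInt hA hS hx.cont (fun _ _ => rfl) h1 ht.1 ht₀.2, ← hx.eq]; abel

theorem Sys.comp {Λ' : Set D} {k : V → D → V} (hk : Sys Λ' k) (hΛ : IsCompact Λ) {π : C → D}
    (hπc : Continuous π) (hπ : ∀ b ∈ Λ, π b ∈ Λ') : Sys Λ (fun y b => k y (π b)) := by
  refine ⟨hΛ, hk.cont.comp (continuous_fst.prodMk (hπc.comp continuous_snd)), fun R => ?_, ?_⟩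
  · obtain ⟨L, hL⟩ := hk.lip R
    exact ⟨L, fun b hb => hL _ (hπ b hb)⟩
  · obtain ⟨c, hc, H⟩ := hk.grow
    exact ⟨c, hc, fun x b hb => H x _ (hπ b hb)⟩

theorem Sys.mk' (hΛ : IsCompact Λ) (hc : Continuous fun z : V × C => h z.1 z.2)
    (hl : ∀ x₀ : V, ∃ ε > (0 : ℝ), ∃ L : NNReal, ∀ b ∈ Λ,
      LipschitzOnWith L (fun x => h x b) (ball x₀ ε))
    (hg : ∃ c > (0 : ℝ), ∀ x, ∀ b ∈ Λ, ‖h x b‖ ≤ c * (1 + ‖x‖)) : Sys Λ h := by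
  refine ⟨hΛ, hc, fun R => ?_, hg⟩
  have : CompactSpace Λ := isCompact_iff_compactSpace.1 hΛ
  have : ProperSpace V := FiniteDimensional.proper ℝ V
  let G : V → C(Λ, V) := fun x => ⟨fun b => h x b, by
    exact hc.comp (continuous_const.prodMk continuous_subtype_val)⟩
  have hG : LocallyLipschitzOn (closedBall 0 R) G := by
    intro x _
    obtain ⟨ε, hε, L, hL⟩ := hl x
    refine ⟨L, ball x ε, mem_nhdsWithin_of_mem_nhds (ball_mem_nhds x hε), ?_⟩
    refine LipschitzOnWith.of_dist_le_mul fun y hy z hz => ?_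
    rw [ContinuousMap.dist_le (by positivity)]
    intro b
    exact (hL b b.2).dist_le_mul y hy z hz
  obtain ⟨L, hL⟩ := hG.exists_lipschitzOnWith_of_compact (isCompact_closedBall 0 R)
  refine ⟨L, fun b hb => LipschitzOnWith.of_dist_le_mul fun y hy z hz => ?_⟩
  exact (ContinuousMap.dist_apply_le_dist (f := G y) (g := G z) ⟨b, hb⟩).trans
    (hL.dist_le_mul y hy z hz)

theorem flowLip (hS : Sys Λ h) {b : C} (hb : b ∈ Λ) {φ : ℝ → V → V} (h0 : ∀ a, φ 0 a = a)
    (hφ : ∀ a s, HasDerivAt (fun r => φ r a) (h (φ s a) b) s) {s : ℝ} (hs : 0 ≤ s) (R : ℝ) :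
    ∃ K : NNReal, LipschitzOnWith K (φ s) (closedBall 0 R) := by
  have : CompleteSpace V := FiniteDimensional.complete ℝ V
  set μ : Measure (ℝ × C) := (volume.restrict (Icc 0 s)).map (fun t => (t, b)) with hμdef
  have hmk : Measurable (fun t : ℝ => (t, b)) := by fun_prop
  have hμ : Adm s Λ μ := by
    refine ⟨?_, ?_⟩
    · rw [hμdef, Measure.map_map measurable_fst hmk]
      exact Measure.map_id.le
    · rw [hμdef, ae_map_iff hmk.aemeasurable (hS.cpt.isClosed.measurableSet.preimage measurable_snd)]
      exact Filter.Eventually.of_forall fun _ => hb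
  have hcφ : ∀ a, Continuous fun r => φ r a := fun a =>
    continuous_iff_continuousAt.2 fun r => (hφ a r).continuousAt
  have hsol : ∀ a, IsSol h μ (fun t => φ (clamp 0 s t) a) := by
    intro a
    have hcc : Continuous fun t => φ (clamp 0 s t) a := (hcφ a).comp (clamp_cont 0 s)
    have key : ∀ t, Fint μ (fun z => h (φ (clamp 0 s z.1) a) z.2) t
        = φ (clamp 0 s t) a - φ 0 a := by
      intro t
      rw [← Fint_clamp' hμ hs]
      have ht := clamp_mem hs t
      set t' := clamp 0 s t
      unfold Fint
      rw [hμdef, setIntegral_map (measSet_le _) (hS.contφ hcc).aestronglyMeasurable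
        hmk.aemeasurable]
      have e : (fun t : ℝ => (t, b)) ⁻¹' {z : ℝ × C | z.1 ≤ t'} = Iic t' := rfl
      rw [e, Measure.restrict_restrict measurableSet_Iic]
      have e2 : Iic t' ∩ Icc 0 s = Icc 0 t' := by
        ext r
        simp only [mem_inter_iff, mem_Iic, mem_Icc]
        exact ⟨fun h => ⟨h.2.1, h.1⟩, fun h => ⟨h.2, h.1, h.2.trans ht.2⟩⟩
      rw [e2, integral_Icc_eq_integral_Ioc, ← intervalIntegral.integral_of_le ht.1]
      have e3 : ∫ r in (0 : ℝ)..t', h (φ (clamp 0 s r) a) b = ∫ r in (0 : ℝ)..t', h (φ r a) b := by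
        apply intervalIntegral.integral_congr
        intro r hr
        rw [uIcc_of_le ht.1] at hr
        simp only
        rw [clamp_of_mem ⟨hr.1, hr.2.trans ht.2⟩]
      simp only
      rw [e3]
      refine intervalIntegral.integral_eq_sub_of_hasDerivAt (f := fun r => φ r a)
        (fun r _ => hφ a r) ?_
      exact (hS.cont.comp ((hcφ a).prodMk continuous_const)).intervalIntegrable _ _
    exact ⟨hcc, fun r t => by rw [key, key]; abel⟩
  obtain ⟨K, hK⟩ := depend' hμ hS (t₀ := 0) ⟨le_rfl, hs⟩ (fun a t => φ (clamp 0 s t) a) hsol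
    (fun a => by rw [clamp_of_mem ⟨le_rfl, hs⟩, h0]) R
  refine ⟨K, ?_⟩
  have := hK s
  simp only [clamp_of_mem (right_mem_Icc.2 hs)] at this
  exact this

theorem hd_of_comm {b : C} {φ : ℝ → V → V} (h0 : ∀ a, φ 0 a = a)
    (hφ : ∀ a s, HasDerivAt (fun r => φ r a) (h (φ s a) b) s) {Ψ : V → V}
    (hΨ : ∀ s, 0 ≤ s → ∀ a, Ψ (φ s a) = φ s (Ψ a)) {y : V} (hd : DifferentiableAt ℝ Ψ y) :
    fderiv ℝ Ψ y (h y b) = h (Ψ y) b := by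
  have d1 : HasDerivAt (fun s => Ψ (φ s y)) (fderiv ℝ Ψ y (h y b)) 0 := by
    have h1 := hφ y 0
    have h2 : HasFDerivAt Ψ (fderiv ℝ Ψ y) (φ 0 y) := by rw [h0]; exact hd.hasFDerivAt
    have h3 := h2.comp_hasDerivAt (0 : ℝ) h1
    rw [h0] at h3
    exact h3
  have d2 : HasDerivAt (fun s => φ s (Ψ y)) (h (Ψ y) b) 0 := by
    have h1 := hφ (Ψ y) 0
    rwa [h0] at h1
  have d3 : HasDerivWithinAt (fun s => φ s (Ψ y)) (fderiv ℝ Ψ y (h y b)) (Ici 0) 0 :=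
    d1.hasDerivWithinAt.congr (fun s hs => (hΨ s hs y).symm) (hΨ 0 le_rfl y).symm
  exact (uniqueDiffWithinAt_Ici (0 : ℝ)).eq_deriv _ d3 d2.hasDerivWithinAt

theorem jointCont (hμ : Adm ϑ Λ μ) (hS : Sys Λ h) {t₀ : ℝ} (ht₀ : t₀ ∈ Icc 0 ϑ)
    {X : V → ℝ → V} (hX : ∀ a, IsSol h μ (X a)) (hX0 : ∀ a, X a t₀ = a) :
    Continuous fun z : V × ℝ => X z.1 z.2 := by
  rw [continuous_iff_continuousAt]
  rintro ⟨a, t⟩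
  obtain ⟨K, hK⟩ := depend' hμ hS ht₀ X hX hX0 (‖a‖ + 1)
  have := continuousOn_prod_of_continuousOn_lipschitzOnWith (fun z : V × ℝ => X z.1 z.2)
    (s := closedBall 0 (‖a‖ + 1)) (t := univ) K (fun a _ => (hX a).cont.continuousOn)
    (fun t _ => hK t)
  refine this.continuousAt (prod_mem_nhds (closedBall_mem_nhds_of_mem (by simp)) Filter.univ_mem)

end Conv

section Core

variable {A : Type*} [MetricSpace A] [SecondCountableTopology A] [MeasurableSpace A] [BorelSpace A]
variable {B : Type*} [MetricSpace B] [SecondCountableTopology B] [MeasurableSpace B] [BorelSpace B]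
variable {V : Type*} [NormedAddCommGroup V] [NormedSpace ℝ V] [FiniteDimensional ℝ V]

theorem sysStar {P : Set A} {Ω : Set B} {f : V → A → V} {g : V → B → V}
    (hf : Sys P f) (hg : Sys Ω g) :
    Sys (({0, 1} : Set ℝ) ×ˢ P ×ˢ Ω)
      (fun x (b : ℝ × A × B) => b.1 • f x b.2.1 + (1 - b.1) • g x b.2.2) := by
  refine ⟨(Set.toFinite _).isCompact.prod (hf.cpt.prod hg.cpt), ?_, fun R => ?_, ?_⟩
  · have h1 : Continuous fun z : V × ℝ × A × B => f z.1 z.2.2.1 :=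
      hf.cont.comp (continuous_fst.prodMk (by fun_prop))
    have h2 : Continuous fun z : V × ℝ × A × B => g z.1 z.2.2.2 :=
      hg.cont.comp (continuous_fst.prodMk (by fun_prop))
    have h3 : Continuous fun z : V × ℝ × A × B => z.2.1 := by fun_prop
    exact (h3.smul h1).add ((continuous_const.sub h3).smul h2)
  · obtain ⟨L1, h1⟩ := hf.lip R
    obtain ⟨L2, h2⟩ := hg.lip R
    refine ⟨max L1 L2, ?_⟩
    rintro ⟨ν, u, ω⟩ ⟨hν, hu, hω⟩
    rcases hν with hν | hν
    · simp only at hν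
      simp only [hν, zero_smul, zero_add, sub_zero, one_smul]
      exact (h2 ω hω).weaken (le_max_right _ _)
    · simp only [mem_singleton_iff] at hν
      simp only [hν, one_smul, sub_self, zero_smul, add_zero]
      exact (h1 u hu).weaken (le_max_left _ _)
  · obtain ⟨c1, hc1, h1⟩ := hf.grow
    obtain ⟨c2, hc2, h2⟩ := hg.grow
    refine ⟨c1 + c2, by positivity, ?_⟩
    rintro x ⟨ν, u, ω⟩ ⟨hν, hu, hω⟩
    have hn : 0 ≤ ‖x‖ := norm_nonneg x
    rcases hν with hν | hν
    · simp only at hν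
      simp only [hν, zero_smul, zero_add, sub_zero, one_smul]
      exact (h2 x ω hω).trans (by gcongr; linarith)
    · simp only [mem_singleton_iff] at hν
      simp only [hν, one_smul, sub_self, zero_smul, add_zero]
      exact (h1 x u hu).trans (by gcongr; linarith)

end Core
end SlideAux

namespace SlideAux

set_option linter.unusedSectionVars false

open Set Metric

section Core

variable {A : Type*} [MetricSpace A] [SecondCountableTopology A] [MeasurableSpace A] [BorelSpace A]
variable {B : Type*} [MetricSpace B] [SecondCountableTopology B] [MeasurableSpace B] [BorelSpace B]
variable {V : Type*} [NormedAddCommGroup V] [NormedSpace ℝ V] [FiniteDimensional ℝ V]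

/-- Solutions of the two systems commute. -/
theorem commSol {ϑ : ℝ} {P : Set A} {Ω : Set B} {f : V → A → V} {g : V → B → V}
    (hf : Sys P f) (hg : Sys Ω g)
    {𝓕 : A → ℝ → V → V} (h𝓕₀ : ∀ u a, 𝓕 u 0 a = a)
    (h𝓕 : ∀ u a s, HasDerivAt (fun r => 𝓕 u r a) (f (𝓕 u s a) u) s)
    {𝓖 : B → ℝ → V → V} (h𝓖₀ : ∀ ω a, 𝓖 ω 0 a = a)
    (h𝓖 : ∀ ω a s, HasDerivAt (fun r => 𝓖 ω r a) (g (𝓖 ω s a) ω) s)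
    (hcomm : ∀ u ∈ P, ∀ ω ∈ Ω, ∀ s r : ℝ, 0 ≤ s → 0 ≤ r → ∀ a, 𝓕 u s (𝓖 ω r a) = 𝓖 ω r (𝓕 u s a))
    {μ : Measure (ℝ × A)} (hμ : Adm ϑ P μ) {t₀ : ℝ} (ht₀ : t₀ ∈ Icc 0 ϑ)
    {X : V → ℝ → V} (hX : ∀ a, IsSol f μ (X a)) (hX0 : ∀ a, X a t₀ = a)
    {σ : Measure (ℝ × B)} (hσ : Adm ϑ Ω σ) {k : ℝ → V} (hk : IsSol g σ k) (t : ℝ) :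
    IsSol g σ (fun s => X (k s) t) := by
  have hϑ : 0 ≤ ϑ := ht₀.1.trans ht₀.2
  have h1 : ∀ ω ∈ Ω, ∀ r, 0 ≤ r → ∀ a, X (𝓖 ω r a) t = 𝓖 ω r (X a t) := by
    intro ω hω r hr a
    have hs : IsSol f μ (fun t => 𝓖 ω r (X a t)) :=
      ml hμ hf hϑ (hX a) (flowLip hg hω (h𝓖₀ ω) (h𝓖 ω) hr) (fun y u hu hd =>
        hd_of_comm (h𝓕₀ u) (h𝓕 u) (fun s hs a => (hcomm u hu ω hω s r hs hr a).symm) hd)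
    have := unique hμ hf ht₀ (hX (𝓖 ω r a)) hs (by rw [hX0, hX0])
    exact congrFun this t
  refine ml hσ hg hϑ hk (Ψ := fun a => X a t) (fun R => ?_) (fun y ω hω hd => ?_)
  · obtain ⟨K, hK⟩ := depend' hμ hf ht₀ X hX hX0 R
    exact ⟨K, hK t⟩
  · exact hd_of_comm (h𝓖₀ ω) (h𝓖 ω) (fun s hs a => h1 ω hω s hs a) hd

theorem slide_mass {C : Type*} [MeasurableSpace C] {ϑ : ℝ} {Λ : Set C} {μ : Measure (ℝ × C)}
    (hμ : IsSlideControl ϑ Λ μ) {s t : ℝ} (hs : 0 ≤ s) (hst : s ≤ t) (ht : t ≤ ϑ) :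
    μ.real {z : ℝ × C | z.1 ∈ Ioc s t} = t - s := by
  have e : μ {z : ℝ × C | z.1 ∈ Ioc s t} = (μ.map Prod.fst) (Ioc s t) := by
    rw [Measure.map_apply measurable_fst measurableSet_Ioc]; rfl
  rw [Measure.real, e, hμ.1, Measure.restrict_apply measurableSet_Ioc, inter_eq_left.2,
    Real.volume_Ioc, ENNReal.toReal_ofReal (by linarith)]
  exact fun r hr => ⟨hs.trans hr.1.le, hr.2.trans ht⟩

set_option maxHeartbeats 1000000 in
theorem core {ϑ : ℝ} {P : Set A} {Ω : Set B} {f : V → A → V} {g : V → B → V}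
    (hf : Sys P f) (hg : Sys Ω g) (hP : P.Nonempty) (hΩ : Ω.Nonempty)
    {𝓕 : A → ℝ → V → V} (h𝓕₀ : ∀ u a, 𝓕 u 0 a = a)
    (h𝓕 : ∀ u a s, HasDerivAt (fun r => 𝓕 u r a) (f (𝓕 u s a) u) s)
    {𝓖 : B → ℝ → V → V} (h𝓖₀ : ∀ ω a, 𝓖 ω 0 a = a)
    (h𝓖 : ∀ ω a s, HasDerivAt (fun r => 𝓖 ω r a) (g (𝓖 ω s a) ω) s)
    (hcomm : ∀ u ∈ P, ∀ ω ∈ Ω, ∀ s r : ℝ, 0 ≤ s → 0 ≤ r → ∀ a, 𝓕 u s (𝓖 ω r a) = 𝓖 ω r (𝓕 u s a))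
    {μ : Measure (ℝ × ℝ × A × B)} (hμ : IsSlideControl ϑ (({0, 1} : Set ℝ) ×ˢ P ×ˢ Ω) μ)
    {t₀ : ℝ} (ht₀ : t₀ ∈ Icc 0 ϑ) {y : ℝ → V}
    (hy : IsSol (fun x (b : ℝ × A × B) => b.1 • f x b.2.1 + (1 - b.1) • g x b.2.2) μ y) :
    ∃ μP : Measure (ℝ × A), IsSlideControl ϑ P μP ∧ ∃ x : ℝ → V, IsSol f μP x ∧ x t₀ = y t₀ ∧
      ∃ τ : ℝ → ℝ, Continuous τ ∧ τ t₀ = t₀ ∧ ∀ T ∈ Icc t₀ ϑ, τ T ∈ Icc t₀ T ∧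
        ∃ σ : Measure (ℝ × B), IsSlideControl ϑ Ω σ ∧ ∃ k : ℝ → V, IsSol g σ k ∧
          k T = y T ∧ k (τ T) = x (τ T) := by
  obtain ⟨u₀, hu₀⟩ := hP
  obtain ⟨ω₀, hω₀⟩ := hΩ
  have hϑ : 0 ≤ ϑ := ht₀.1.trans ht₀.2
  set Λ : Set (ℝ × A × B) := ({0, 1} : Set ℝ) ×ˢ P ×ˢ Ω with hΛ
  have hS := sysStar hf hg
  have hΛc : IsCompact Λ := hS.cpt
  have hA := IsSlide.adm hμ
  set S : Set (ℝ × ℝ × A × B) := {z | z.2.1 = 1} with hSdef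
  have hSm : MeasurableSet S := by
    have : Measurable fun z : ℝ × ℝ × A × B => z.2.1 := by fun_prop
    exact this (measurableSet_singleton 1)
  have hA1' : Adm ϑ Λ (μ.restrict S) := hA.mono Measure.restrict_le_self
  have hA0' : Adm ϑ Λ (μ.restrict Sᶜ) := hA.mono Measure.restrict_le_self
  set ν := (μ.restrict S).restrict {z | z.1 ∈ Ioc t₀ ϑ} with hν
  have hν1 : Adm ϑ Λ ν := hA1'.mono Measure.restrict_le_self
  have hπ1 : Continuous fun b : ℝ × A × B => b.2.1 := by fun_prop
  have hπ0 : Continuous fun b : ℝ × A × B => b.2.2 := by fun_prop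
  have hνT : ∀ T ≤ ϑ, ν.restrict {z | z.1 ∈ Ioc t₀ T}
      = (μ.restrict S).restrict {z | z.1 ∈ Ioc t₀ T} := by
    intro T hT
    rw [hν, Measure.restrict_restrict (measSet_Ioc _ _)]
    congr 1
    ext z
    simp only [mem_inter_iff, mem_ofPred_eq, mem_Ioc]
    exact ⟨fun h => h.1, fun h => ⟨h, h.1, h.2.trans hT⟩⟩
  have hνge : ∀ᵐ z ∂ν, t₀ ≤ z.1 := by
    filter_upwards [ae_restrict_mem (measSet_Ioc t₀ ϑ)] with z hz using hz.1.le
  have hτ0 : clk ν t₀ = 0 := clk_zero hν1 hνge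
  -- mass balance
  have hsum : ∀ T ≤ ϑ, ν.restrict {z | z.1 ∈ Ioc t₀ T}
      + (μ.restrict Sᶜ).restrict {z | z.1 ∈ Ioc t₀ T} = μ.restrict {z | z.1 ∈ Ioc t₀ T} := by
    intro T hT
    rw [hνT T hT, ← Measure.restrict_add, Measure.restrict_add_restrict_compl hSm]
  have hmass : ∀ T ∈ Icc t₀ ϑ, t₀ + clk ν T
      + ((μ.restrict Sᶜ).restrict {z | z.1 ∈ Ioc t₀ T}).real univ = T := by
    intro T hT
    have e1 : clk ν T = (ν.restrict {z | z.1 ∈ Ioc t₀ T}).real univ := by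
      have := clk_sub hν1 hT.1
      rw [hτ0, sub_zero] at this
      rw [this]; simp [Measure.real]
    have := hA.finite
    have := hν1.finite
    have e2 := congrArg (fun m : Measure (ℝ × ℝ × A × B) => m.real univ) (hsum T hT.2)
    rw [measureReal_add_apply] at e2
    have e3 : (μ.restrict {z | z.1 ∈ Ioc t₀ T}).real univ = T - t₀ := by
      rw [← slide_mass hμ ht₀.1 hT.1 hT.2]; simp [Measure.real]
    rw [e3] at e2
    rw [e1]; linarith
  have hνm : clk ν ϑ = ν.real univ :=
    clk_top (by filter_upwards [hν1.time] with z hz using hz.2)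
  obtain ⟨μP, hμP, HP⟩ := timeChange (V := V) hν1 hΛc hϑ hf.cpt hπ1 (fun b hb => hb.2.1) hu₀
    (a := t₀) ht₀.1 (by
      have := hmass ϑ ⟨ht₀.2, le_rfl⟩
      have h2 : 0 ≤ ((μ.restrict Sᶜ).restrict {z | z.1 ∈ Ioc t₀ ϑ}).real univ := measureReal_nonneg
      rw [← hνm]; linarith)
  have hμPA := IsSlide.adm hμP
  choose X hX hX0 using fun a => exist hμPA hf ht₀ a
  have hXc := jointCont hμPA hf ht₀ hX hX0
  refine ⟨μP, hμP, X (y t₀), hX _, hX0 _, fun t => t₀ + clk ν t,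
    continuous_const.add (clk_cont hν1 hΛc), by simp [hτ0], fun T hT => ?_⟩
  have hb := hmass T hT
  set κ := (μ.restrict Sᶜ).restrict {z | z.1 ∈ Ioc t₀ T} with hκ
  have hκA : Adm ϑ Λ κ := hA0'.mono Measure.restrict_le_self
  have hκ0 : 0 ≤ κ.real univ := measureReal_nonneg
  have hνT0 : 0 ≤ clk ν T := clk_nonneg T
  refine ⟨⟨by simp only; linarith, by simp only; linarith⟩, ?_⟩
  obtain ⟨σ, hσ, Hσ⟩ := timeChange (V := V) hκA hΛc hϑ hg.cpt hπ0 (fun b hb => hb.2.2) hω₀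
    (a := t₀ + clk ν T) (by linarith [ht₀.1]) (by rw [hb]; exact hT.2)
  have hσA := IsSlide.adm hσ
  obtain ⟨k, hk, hk0⟩ := exist hσA hg (t₀ := t₀ + clk ν T)
    ⟨by linarith [ht₀.1], by linarith [hT.2]⟩ (y t₀)
  have hkX : ∀ t, IsSol g σ (fun s => X (k s) t) := fun t =>
    commSol hf hg h𝓕₀ h𝓕 h𝓖₀ h𝓖 hcomm hμPA ht₀ hX hX0 hσA hk t
  refine ⟨σ, hσ, fun s => X (k s) (t₀ + clk ν T), hkX _, ?_, by simp only; rw [hk0]⟩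
  -- diagonal
  have hdiag : IsSol (fun x (b : ℝ × A × B) => b.1 • f x b.2.1 + (1 - b.1) • g x b.2.2)
      (ν.restrict {z | z.1 ∈ Ioc t₀ T} + κ)
      (fun t => X (k (t₀ + clk ν T + clk κ t)) (t₀ + clk ν (clamp t₀ T t))) := by
    have hsf := hf.comp hΛc hπ1 (fun b hb => hb.2.1)
    have hsg := hg.comp hΛc hπ0 (fun b hb => hb.2.2)
    refine diag (W := fun s t => X (k (t₀ + clk ν T + clk κ s)) (t₀ + clk ν (clamp t₀ T t)))
      (hν1.mono Measure.restrict_le_self) hκA hsf hsg ?_ ?_ ?_ ?_ ?_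
    · have c1 : Continuous fun z : ℝ × ℝ => k (t₀ + clk ν T + clk κ z.1) :=
        hk.cont.comp (continuous_const.add ((clk_cont hκA hΛc).comp continuous_fst))
      have c2 : Continuous fun z : ℝ × ℝ => t₀ + clk ν (clamp t₀ T z.2) :=
        continuous_const.add ((clk_cont hν1 hΛc).comp ((clamp_cont _ _).comp continuous_snd))
      exact hXc.comp (c1.prodMk c2)
    · intro s
      exact stopSol hν1 hsf hT.1 (HP f hf _ (hX (k (t₀ + clk ν T + clk κ s))))
    · intro t
      exact Hσ g hg _ (hkX (t₀ + clk ν (clamp t₀ T t)))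
    · rw [hνT T hT.2]
      have h1 : ∀ᵐ z ∂(μ.restrict S), z.2.1 = 1 := ae_restrict_mem hSm
      filter_upwards [ae_restrict_of_ae h1] with z hz x
      simp [hz]
    · have h1 : ∀ᵐ z ∂(μ.restrict Sᶜ), z.2.1 ≠ 1 := ae_restrict_mem hSm.compl
      filter_upwards [ae_restrict_of_ae h1, hκA.supp] with z hz hz2 x
      have h0 : z.2.1 = 0 := by
        rcases hz2.1 with h | h
        · exact h
        · exact absurd h hz
      simp [h0]
  rw [hsum T hT.2] at hdiag
  have hst := stopSol hA hS hT.1 hy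
  have hκge : ∀ᵐ z ∂κ, t₀ ≤ z.1 := by
    filter_upwards [ae_restrict_mem (measSet_Ioc t₀ T)] with z hz using hz.1.le
  have hκle : ∀ᵐ z ∂κ, z.1 ≤ T := by
    filter_upwards [ae_restrict_mem (measSet_Ioc t₀ T)] with z hz using hz.2
  have heq := unique (hA.mono Measure.restrict_le_self) hS ht₀ hdiag hst (by
    rw [clamp_of_mem ⟨le_rfl, hT.1⟩, hτ0, clk_zero hκA hκge, add_zero, add_zero, hX0, hk0])
  have := congrFun heq T
  rw [clamp_of_mem ⟨hT.1, le_rfl⟩, clk_top hκle, hb] at this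
  exact this

end Core
end SlideAux

namespace SlideAux

set_option linter.unusedSectionVars false

open Set Metric

section Concat

variable {A : Type*} [MetricSpace A] [SecondCountableTopology A] [MeasurableSpace A] [BorelSpace A]
variable {B : Type*} [MetricSpace B] [SecondCountableTopology B] [MeasurableSpace B] [BorelSpace B]
variable {V : Type*} [NormedAddCommGroup V] [NormedSpace ℝ V] [FiniteDimensional ℝ V]

theorem concat {ϑ : ℝ} {P : Set A} {Ω : Set B} {f : V → A → V} {g : V → B → V}
    (hf : Sys P f) (hg : Sys Ω g) (hP : P.Nonempty) (hΩ : Ω.Nonempty)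
    {μ : Measure (ℝ × A)} (hμ : IsSlideControl ϑ P μ) {y : ℝ → V} (hy : IsSol f μ y)
    {σ : Measure (ℝ × B)} (hσ : IsSlideControl ϑ Ω σ) {z : ℝ → V} (hz : IsSol g σ z)
    {ξ : ℝ} (hyz : y ξ = z ξ) :
    ∃ κ : Measure (ℝ × ℝ × A × B), IsSlideControl ϑ (({0, 1} : Set ℝ) ×ˢ P ×ˢ Ω) κ ∧
      ∃ w : ℝ → V,
        IsSol (fun x (b : ℝ × A × B) => b.1 • f x b.2.1 + (1 - b.1) • g x b.2.2) κ w ∧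
        (∀ t ≤ ξ, w t = y t) ∧ ∀ t, ξ ≤ t → w t = z t := by
  obtain ⟨u₀, hu₀⟩ := hP
  obtain ⟨ω₀, hω₀⟩ := hΩ
  have hS := sysStar hf hg
  have hμA := IsSlide.adm hμ
  have hσA := IsSlide.adm hσ
  set T1 : ℝ × A → ℝ × ℝ × A × B := fun p => (p.1, 1, p.2, ω₀) with hT1
  set T0 : ℝ × B → ℝ × ℝ × A × B := fun p => (p.1, 0, u₀, p.2) with hT0
  have hT1c : Continuous T1 := by fun_prop
  have hT0c : Continuous T0 := by fun_prop
  set m1 := (μ.restrict (Prod.fst ⁻¹' Iic ξ)).map T1 with hm1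
  set m0 := (σ.restrict (Prod.fst ⁻¹' Ioi ξ)).map T0 with hm0
  have hk : IsSlideControl ϑ (({0, 1} : Set ℝ) ×ˢ P ×ˢ Ω) (m1 + m0) := by
    constructor
    · rw [Measure.map_add _ _ measurable_fst, hm1, hm0,
        Measure.map_map measurable_fst hT1c.measurable,
        Measure.map_map measurable_fst hT0c.measurable]
      change (μ.restrict (Prod.fst ⁻¹' Iic ξ)).map Prod.fst
        + (σ.restrict (Prod.fst ⁻¹' Ioi ξ)).map Prod.fst = _
      rw [← Measure.restrict_map measurable_fst measurableSet_Iic,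
        ← Measure.restrict_map measurable_fst measurableSet_Ioi, hμ.1, hσ.1, ← compl_Iic,
        Measure.restrict_add_restrict_compl measurableSet_Iic]
    · have hms : MeasurableSet (Icc 0 ϑ ×ˢ (({0, 1} : Set ℝ) ×ˢ P ×ˢ Ω))ᶜ :=
        (measurableSet_Icc.prod hS.cpt.isClosed.measurableSet).compl
      rw [Measure.add_apply, hm1, hm0, Measure.map_apply hT1c.measurable hms,
        Measure.map_apply hT0c.measurable hms, add_eq_zero]
      constructor
      · have : ∀ᵐ p ∂(μ.restrict (Prod.fst ⁻¹' Iic ξ)),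
            T1 p ∈ Icc 0 ϑ ×ˢ (({0, 1} : Set ℝ) ×ˢ P ×ˢ Ω) := by
          filter_upwards [ae_restrict_of_ae hμA.time, ae_restrict_of_ae hμA.supp] with p h1 h2
          exact ⟨h1, by simp [hT1], h2, hω₀⟩
        exact this
      · have : ∀ᵐ p ∂(σ.restrict (Prod.fst ⁻¹' Ioi ξ)),
            T0 p ∈ Icc 0 ϑ ×ˢ (({0, 1} : Set ℝ) ×ˢ P ×ˢ Ω) := by
          filter_upwards [ae_restrict_of_ae hσA.time, ae_restrict_of_ae hσA.supp] with p h1 h2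
          exact ⟨h1, by simp [hT0], hu₀, h2⟩
        exact this
  set w : ℝ → V := fun t => y (min t ξ) + (z (max t ξ) - z ξ) with hw
  have hwc : Continuous w := by
    have h1 := hy.cont
    have h2 := hz.cont
    fun_prop
  have hw1 : ∀ t ≤ ξ, w t = y t := by
    intro t ht; simp only [hw]; rw [min_eq_left ht, max_eq_right ht]; abel
  have hw0 : ∀ t, ξ ≤ t → w t = z t := by
    intro t ht; simp only [hw]; rw [min_eq_right ht, max_eq_left ht, hyz]; abel
  refine ⟨m1 + m0, hk, w, ⟨hwc, ?_⟩, hw1, hw0⟩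
  set φ : ℝ × ℝ × A × B → V :=
    fun p => p.2.1 • f (w p.1) p.2.2.1 + (1 - p.2.1) • g (w p.1) p.2.2.2 with hφ
  have hφc : Continuous φ := hS.contφ hwc
  have hφi : Integrable φ (m1 + m0) := (IsSlide.adm hk).integrable hS.cpt hφc
  have hgi : Integrable (fun p : ℝ × B => g (z p.1) p.2) σ :=
    hσA.integrable hg.cpt (hg.contφ hz.cont)
  have hF : ∀ t, Fint (m1 + m0) φ t = Fint μ (fun p => f (y p.1) p.2) (min t ξ)
      + (Fint σ (fun p => g (z p.1) p.2) (max t ξ) - Fint σ (fun p => g (z p.1) p.2) ξ) := by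
    intro t
    rw [Fint_sub hgi (le_max_right _ _)]
    unfold Fint
    rw [Measure.restrict_add, integral_add_measure hφi.left_of_add_measure.integrableOn
      hφi.right_of_add_measure.integrableOn]
    congr 1
    · rw [hm1, setIntegral_map (measSet_le _) hφc.aestronglyMeasurable
        hT1c.measurable.aemeasurable, Measure.restrict_restrict (hT1c.measurable (measSet_le _))]
      have e : T1 ⁻¹' {p : ℝ × ℝ × A × B | p.1 ≤ t} ∩ Prod.fst ⁻¹' Iic ξ
          = {p : ℝ × A | p.1 ≤ min t ξ} := by
        ext p
        simp [hT1]
      rw [e]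
      refine setIntegral_congr_fun (measSet_le _) ?_
      intro p hp
      have hp2 : p.1 ≤ ξ := le_trans hp (min_le_right _ _)
      simp [hφ, hT1, hw1 _ hp2]
    · rw [hm0, setIntegral_map (measSet_le _) hφc.aestronglyMeasurable
        hT0c.measurable.aemeasurable, Measure.restrict_restrict (hT0c.measurable (measSet_le _))]
      have e : T0 ⁻¹' {p : ℝ × ℝ × A × B | p.1 ≤ t} ∩ Prod.fst ⁻¹' Ioi ξ
          = {p : ℝ × B | p.1 ∈ Ioc ξ (max t ξ)} := by
        ext p
        simp only [hT0, mem_inter_iff, mem_preimage, mem_ofPred_eq, mem_Ioi, mem_Ioc, le_max_iff]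
        exact ⟨fun h => ⟨h.2, Or.inl h.1⟩, fun h => ⟨h.2.resolve_right (not_le.2 h.1), h.1⟩⟩
      rw [e]
      refine setIntegral_congr_fun (measSet_Ioc _ _) ?_
      intro p hp
      simp [hφ, hT0, hw0 _ hp.1.le]
  intro s t
  change w t - w s = Fint (m1 + m0) φ t - Fint (m1 + m0) φ s
  rw [hF, hF]
  have e1 := hy.eq (min s ξ) (min t ξ)
  have e2 := hz.eq (max s ξ) (max t ξ)
  have g1 : ∀ a b c d e : V, (a + (b - e)) - (c + (d - e)) = (a - c) + (b - d) :=
    fun a b c d e => by abel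
  simp only [hw]
  rw [g1, g1, e1, e2]

end Concat
end SlideAux

/-- Lemma 3 of the paper: under the commutation hypothesis on the flows,
if `E` is closed, `M ⊆ E` and `E` decreases by sections relative to `ẋ = g(x,ω)`,
`ω ∈ Ω`, then `A(E) = A*(E)`. -/
theorem progAbsorb_eq_progAbsorbStar
    {n p q m : ℕ} (ϑ : ℝ) (hϑ : 0 < ϑ)
    (P : Set (EuclideanSpace ℝ (Fin p))) (Q : Set (EuclideanSpace ℝ (Fin q)))
    (Ω : Set (EuclideanSpace ℝ (Fin m)))
    (hPne : P.Nonempty) (hPc : IsCompact P)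
    (hQne : Q.Nonempty) (hQc : IsCompact Q)
    (hΩne : Ω.Nonempty) (hΩc : IsCompact Ω)
    (f : EuclideanSpace ℝ (Fin n) → EuclideanSpace ℝ (Fin p) → EuclideanSpace ℝ (Fin q) →
      EuclideanSpace ℝ (Fin n))
    (g : EuclideanSpace ℝ (Fin n) → EuclideanSpace ℝ (Fin m) → EuclideanSpace ℝ (Fin n))
    (hf : Continuous fun z : EuclideanSpace ℝ (Fin n) × EuclideanSpace ℝ (Fin p) ×
      EuclideanSpace ℝ (Fin q) => f z.1 z.2.1 z.2.2)
    (hg : Continuous fun z : EuclideanSpace ℝ (Fin n) × EuclideanSpace ℝ (Fin m) => g z.1 z.2)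
    (hfLip : ∀ x₀ : EuclideanSpace ℝ (Fin n), ∃ ε > (0 : ℝ), ∃ L : NNReal,
      ∀ u ∈ P, ∀ v ∈ Q, LipschitzOnWith L (fun x => f x u v) (Metric.ball x₀ ε))
    (hgLip : ∀ x₀ : EuclideanSpace ℝ (Fin n), ∃ ε > (0 : ℝ), ∃ L : NNReal,
      ∀ ω ∈ Ω, LipschitzOnWith L (fun x => g x ω) (Metric.ball x₀ ε))
    (hfGrow : ∃ c > (0 : ℝ), ∀ x, ∀ u ∈ P, ∀ v ∈ Q, ‖f x u v‖ ≤ c * (1 + ‖x‖))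
    (hgGrow : ∃ c > (0 : ℝ), ∀ x, ∀ ω ∈ Ω, ‖g x ω‖ ≤ c * (1 + ‖x‖))
    (M : Set (ℝ × EuclideanSpace ℝ (Fin n))) (hMcl : IsClosed M)
    (F : Set (EuclideanSpace ℝ (Fin n))) (hF : F = {x | (ϑ, x) ∈ M})
    -- `M` is the controllability set of `ẋ = g(x,ω)`, `ω ∈ Ω`, with target `{ϑ} × F`:
    (hM : M = {px : ℝ × EuclideanSpace ℝ (Fin n) | px.1 ∈ Set.Icc 0 ϑ ∧
      ∃ xF ∈ F, ∃ σ : Measure (ℝ × EuclideanSpace ℝ (Fin m)), IsSlideControl ϑ Ω σ ∧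
        ∃ y : ℝ → EuclideanSpace ℝ (Fin n), IsMotion ϑ Ω g σ ϑ xF y ∧ y px.1 = px.2})
    (E : Set (ℝ × EuclideanSpace ℝ (Fin n))) (hEcl : IsClosed E)
    (hEsub : E ⊆ Set.Icc 0 ϑ ×ˢ (Set.univ : Set (EuclideanSpace ℝ (Fin n))))
    -- `𝓕` is the flow of the constant-control systems `ẋ = f(x,u,v)`:
    (𝓕 : EuclideanSpace ℝ (Fin p) → EuclideanSpace ℝ (Fin q) → ℝ →
      EuclideanSpace ℝ (Fin n) → EuclideanSpace ℝ (Fin n))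
    (h𝓕₀ : ∀ u v x₀, 𝓕 u v 0 x₀ = x₀)
    (h𝓕 : ∀ u v x₀ τ, HasDerivAt (fun τ' => 𝓕 u v τ' x₀) (f (𝓕 u v τ x₀) u v) τ)
    -- `𝓖` is the flow of the constant-control systems `ẋ = g(x,ω)`:
    (𝓖 : EuclideanSpace ℝ (Fin m) → ℝ →
      EuclideanSpace ℝ (Fin n) → EuclideanSpace ℝ (Fin n))
    (h𝓖₀ : ∀ ω x₀, 𝓖 ω 0 x₀ = x₀)
    (h𝓖 : ∀ ω x₀ τ, HasDerivAt (fun τ' => 𝓖 ω τ' x₀) (g (𝓖 ω τ x₀) ω) τ)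
    -- the commutation hypothesis:
    (hcomm : ∀ u ∈ P, ∀ v ∈ Q, ∀ ω ∈ Ω, ∀ τ' τ'' : ℝ, 0 ≤ τ' → 0 ≤ τ'' →
      (𝓕 u v τ') ∘ (𝓖 ω τ'') = (𝓖 ω τ'') ∘ (𝓕 u v τ'))
    (hME : M ⊆ E) (hEdec : DecreasesBySections ϑ Ω g E) :
    progAbsorb ϑ P Q f M E = progAbsorbStar ϑ P Q Ω f g F E := by
  have hSg : SlideAux.Sys Ω g := SlideAux.Sys.mk' hΩc hg hgLip hgGrow
  have hSf : ∀ v ∈ Q, SlideAux.Sys P (fun x u => f x u v) := by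
    intro v hv
    refine SlideAux.Sys.mk' hPc ?_ ?_ ?_
    · exact hf.comp (continuous_fst.prodMk (continuous_snd.prodMk continuous_const))
    · intro x₀
      obtain ⟨ε, hε, L, hL⟩ := hfLip x₀
      exact ⟨ε, hε, L, fun u hu => hL u hu v hv⟩
    · obtain ⟨c, hc, H⟩ := hfGrow
      exact ⟨c, hc, fun x u hu => H x u hu v hv⟩
  have hϑm : ϑ ∈ Set.Icc 0 ϑ := ⟨hϑ.le, le_rfl⟩
  ext ⟨t₀, x₀⟩
  constructor
  · rintro ⟨hE, H⟩
    refine ⟨hE, fun v hv => ?_⟩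
    have ht₀ : t₀ ∈ Set.Icc 0 ϑ := (hEsub hE).1
    obtain ⟨μ, hμ, ξ, hξ, y, hy, hyM, hyE⟩ := H v hv
    rw [hM] at hyM
    obtain ⟨hξ0, xF, hxF, σ, hσ, z, hz, hzξ⟩ := hyM
    simp only at hξ0 hzξ hξ hy hyE
    have hys := SlideAux.toSol hμ (hSf v hv) ht₀ hy
    have hzs := SlideAux.toSol hσ hSg hϑm hz
    obtain ⟨κ, hκ, w, hw, hw1, hw0⟩ := SlideAux.concat (hSf v hv) hSg hPne hΩne hμ hys hσ hzs
      (ξ := ξ) (by rw [SlideAux.clamp_of_mem hξ0, hzξ])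
    have hwy : ∀ t ∈ Set.Icc t₀ ξ, w t = y t := by
      intro t ht
      rw [hw1 t ht.2, SlideAux.clamp_of_mem ⟨ht₀.1.trans ht.1, ht.2.trans hξ.2⟩]
    have hwz : ∀ t ∈ Set.Icc ξ ϑ, w t = z t := by
      intro t ht
      rw [hw0 t ht.1, SlideAux.clamp_of_mem ⟨hξ0.1.trans ht.1, ht.2⟩]
    have hmot := SlideAux.ofSol hκ (SlideAux.sysStar (hSf v hv) hSg) ht₀ hw
    rw [hwy t₀ ⟨le_rfl, hξ.1⟩, hy.2.1] at hmot
    refine ⟨κ, hκ, w, hmot, ?_, ?_⟩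
    · rw [hwz ϑ ⟨hξ.2, le_rfl⟩, hz.2.1]; exact hxF
    · intro t ht
      rcases le_total t ξ with h1 | h1
      · rw [hwy t ⟨ht.1, h1⟩]; exact hyE t ⟨ht.1, h1⟩
      · rw [hwz t ⟨h1, ht.2⟩]
        apply hME
        rw [hM]
        exact ⟨⟨hξ0.1.trans h1, ht.2⟩, xF, hxF, σ, hσ, z, hz, rfl⟩
  · rintro ⟨hE, H⟩
    refine ⟨hE, fun v hv => ?_⟩
    have ht₀ : t₀ ∈ Set.Icc 0 ϑ := (hEsub hE).1
    obtain ⟨μ, hμ, y, hy, hyF, hyE⟩ := H v hv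
    simp only at hy hyE
    have hys := SlideAux.toSol hμ (SlideAux.sysStar (hSf v hv) hSg) ht₀ hy
    obtain ⟨μP, hμP, x, hx, hx0, τ, hτc, hτ0, hτ⟩ := SlideAux.core (hSf v hv) hSg hPne hΩne
      (𝓕 := fun u => 𝓕 u v) (fun u a => h𝓕₀ u v a) (fun u a s => h𝓕 u v a s)
      (𝓖 := 𝓖) h𝓖₀ h𝓖
      (fun u hu ω hω s r hs hr a => congrFun (hcomm u hu v hv ω hω s r hs hr) a) hμ ht₀ hys
    have hc : ∀ t ∈ Set.Icc t₀ ϑ, y (SlideAux.clamp 0 ϑ t) = y t := fun t ht => by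
      rw [SlideAux.clamp_of_mem ⟨ht₀.1.trans ht.1, ht.2⟩]
    rw [hc t₀ ⟨le_rfl, ht₀.2⟩, hy.2.1] at hx0
    have hmot := SlideAux.ofSol hμP (hSf v hv) ht₀ hx
    rw [hx0] at hmot
    have hϑ1 : ϑ ∈ Set.Icc t₀ ϑ := ⟨ht₀.2, le_rfl⟩
    obtain ⟨hξ, σ, hσ, k, hk, hkϑ, hkξ⟩ := hτ ϑ hϑ1
    refine ⟨μP, hμP, τ ϑ, hξ, x, hmot, ?_, ?_⟩
    · rw [hM]
      refine ⟨⟨ht₀.1.trans hξ.1, hξ.2⟩, y ϑ, hyF, σ, hσ, k, ?_, hkξ⟩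
      have := SlideAux.ofSol hσ hSg hϑm hk
      rwa [hkϑ, hc ϑ hϑ1] at this
    · intro t ht
      obtain ⟨T, hT, rfl⟩ := intermediate_value_Icc ht₀.2 hτc.continuousOn
        (show t ∈ Set.Icc (τ t₀) (τ ϑ) by rw [hτ0]; exact ht)
      obtain ⟨hτT, σ', hσ', k', hk', hkT, hkτ⟩ := hτ T hT
      have hmk := SlideAux.ofSol hσ' hSg ⟨ht₀.1.trans hT.1, hT.2⟩ hk'
      rw [hkT, hc T hT] at hmk
      rw [← hkτ]
      exact hEdec T (y T) (hyE T hT) (τ T) ⟨ht₀.1.trans hτT.1, hτT.2⟩ σ' hσ' k' hmk
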